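/- Let w be an Oleinik solution on [0,X], let 0 < ε < X, let k ≥ 2 be an integer, and assume the induction hypothesis (IH_k) holds on [ε/2,X]×(0,δ₃] for some δ₃ ∈ (0,1) with δ₃ ≤ δ₁. Then there exist δ₄ ∈ (0,δ₃] and a constant C > 0, independent of ψ, such that for all (x,ψ) ∈ [ε,X]×(0,δ₄]: |∂_ψ ∂ₓ^k w(x,ψ)| ≤ C, |∂_ψ² ∂ₓ^k w(x,ψ)| ≤ C ψ^{−1}, and |∂ₓ^{k+1} w(x,ψ)| ≤ C ψ^{−1/2}. -/

import Mathlib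

open Set

/-- Iterated partial derivative `∂ₓ^k ∂_ψ^m w` of a function of two real variables. -/
noncomputable def pd (k m : ℕ) (w : ℝ → ℝ → ℝ) (x ψ : ℝ) : ℝ :=
  iteratedDeriv k (fun x' => iteratedDeriv m (w x') ψ) x

/-- Von Mises formulation of the steady Prandtl equation with favorable pressure:
`w` is an Oleinik solution on `[0,X]` with structural constants `α, m, M, C₀, δ₁`. -/
structure OleinikSolution (X : ℝ) (p : ℝ → ℝ) (w : ℝ → ℝ → ℝ)
    (α m M C₀ δ₁ : ℝ) : Prop where
  hX : 0 < X
  hp : ContDiff ℝ (⊤ : ℕ∞) p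
  hfav : ∀ x : ℝ, deriv p x ≤ 0
  hα : α ∈ Set.Ioo (0 : ℝ) (1 / 2)
  hm : 0 < m
  hmM : m < M
  hC₀ : 0 < C₀
  hδ₁ : δ₁ ∈ Set.Ioo (0 : ℝ) 1
  cont : ContinuousOn (fun z : ℝ × ℝ => w z.1 z.2) (Set.Icc 0 X ×ˢ Set.Ici 0)
  smooth : ContDiffOn ℝ (⊤ : ℕ∞) (fun z : ℝ × ℝ => w z.1 z.2) (Set.Ioc 0 X ×ˢ Set.Ioi 0)
  bdry : ∀ x ∈ Set.Icc (0 : ℝ) X, w x 0 = 0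
  eqn : ∀ x ∈ Set.Ioc (0 : ℝ) X, ∀ ψ ∈ Set.Ioi (0 : ℝ),
    pd 1 0 w x ψ - Real.sqrt (w x ψ) * pd 0 2 w x ψ = -2 * deriv p x
  slope_lb : ∀ x ∈ Set.Icc (0 : ℝ) X, ∀ ψ ∈ Set.Icc (0 : ℝ) δ₁, m < pd 0 1 w x ψ
  slope_ub : ∀ x ∈ Set.Icc (0 : ℝ) X, ∀ ψ ∈ Set.Icc (0 : ℝ) δ₁, pd 0 1 w x ψ < M
  growth_lb : ∀ x ∈ Set.Icc (0 : ℝ) X, ∀ ψ ∈ Set.Ioc (0 : ℝ) δ₁, m * ψ < w x ψ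
  growth_ub : ∀ x ∈ Set.Icc (0 : ℝ) X, ∀ ψ ∈ Set.Ioc (0 : ℝ) δ₁, w x ψ < M * ψ
  dx_bound : ∀ x ∈ Set.Icc (0 : ℝ) X, ∀ ψ ∈ Set.Icc (0 : ℝ) δ₁,
    |pd 1 0 w x ψ| ≤ C₀ * ψ ^ ((1 : ℝ) / 2 + α)

/-- The induction hypothesis `(IH_k)` on a region `R`, with constant `C₁`:
for all `(x,ψ) ∈ R` and all `0 ≤ j ≤ k-1`, `|∂_ψ ∂ₓ^j w| ≤ C₁`,
`|∂_ψ² ∂ₓ^j w| ≤ C₁ ψ⁻¹`, `|∂ₓ^j w| ≤ C₁ ψ`, `|∂ₓ^j √w| ≤ C₁ ψ^{1/2}`,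
and additionally `|∂ₓ^k w| ≤ C₁ ψ^{-1/2}`. -/
def IH (k : ℕ) (w : ℝ → ℝ → ℝ) (R : Set (ℝ × ℝ)) (C₁ : ℝ) : Prop :=
  ∀ z ∈ R,
    (∀ j ≤ k - 1,
      |pd j 1 w z.1 z.2| ≤ C₁ ∧
      |pd j 2 w z.1 z.2| ≤ C₁ * z.2⁻¹ ∧
      |pd j 0 w z.1 z.2| ≤ C₁ * z.2 ∧
      |pd j 0 (fun x' ψ' => Real.sqrt (w x' ψ')) z.1 z.2| ≤ C₁ * z.2 ^ ((1 : ℝ) / 2)) ∧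
    |pd k 0 w z.1 z.2| ≤ C₁ * z.2 ^ (-(1 : ℝ) / 2)


open scoped ContDiff Topology
open Filter

noncomputable def Dx (u : ℝ → ℝ → ℝ) : ℝ → ℝ → ℝ := fun x y => deriv (fun x' => u x' y) x
noncomputable def Dy (u : ℝ → ℝ → ℝ) : ℝ → ℝ → ℝ := fun x y => deriv (u x) y

def Sm (Ω : Set (ℝ × ℝ)) (u : ℝ → ℝ → ℝ) : Prop :=
  ContDiffOn ℝ ∞ (fun z : ℝ × ℝ => u z.1 z.2) Ω

def EqR (Ω : Set (ℝ × ℝ)) (u v : ℝ → ℝ → ℝ) : Prop := ∀ x y, (x, y) ∈ Ω → u x y = v x y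

lemma pd_eq (k m : ℕ) (w : ℝ → ℝ → ℝ) : pd k m w = Dx^[k] (Dy^[m] w) := by
  have h1 : ∀ (m : ℕ) (w : ℝ → ℝ → ℝ), (fun x y => iteratedDeriv m (w x) y) = Dy^[m] w := by
    intro m
    induction m with
    | zero => intro w; funext x y; simp
    | succ m ih =>
      intro w
      rw [Function.iterate_succ_apply', ← ih]
      funext x y
      rw [iteratedDeriv_succ]; rfl
  have h2 : ∀ (k : ℕ) (w : ℝ → ℝ → ℝ), (fun x y => iteratedDeriv k (fun x' => w x' y) x) = Dx^[k] w := by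
    intro m
    induction m with
    | zero => intro w; funext x y; simp
    | succ m ih =>
      intro w
      rw [Function.iterate_succ_apply', ← ih]
      funext x y
      rw [iteratedDeriv_succ]; rfl
  rw [← h2, ← h1]
  rfl

section basic
variable {Ω : Set (ℝ × ℝ)} (hΩ : IsOpen Ω)

lemma Sm.mono {Ω' : Set (ℝ × ℝ)} (h : Ω' ⊆ Ω) {u} (hu : Sm Ω u) : Sm Ω' u := ContDiffOn.mono hu h

lemma Sm.congr {u v} (hu : Sm Ω u) (h : EqR Ω v u) : Sm Ω v :=
  ContDiffOn.congr hu (fun z hz => h z.1 z.2 hz)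

lemma Sm.mul {u v} (hu : Sm Ω u) (hv : Sm Ω v) : Sm Ω (fun x y => u x y * v x y) :=
  ContDiffOn.mul hu hv
lemma Sm.add {u v} (hu : Sm Ω u) (hv : Sm Ω v) : Sm Ω (fun x y => u x y + v x y) :=
  ContDiffOn.add hu hv

include hΩ in
lemma evx {x y : ℝ} (h : (x, y) ∈ Ω) : ∀ᶠ x' in 𝓝 x, (x', y) ∈ Ω :=
  (Continuous.tendsto (by fun_prop : Continuous fun x' : ℝ => (x', y)) x) (hΩ.mem_nhds h)
include hΩ in
lemma evy {x y : ℝ} (h : (x, y) ∈ Ω) : ∀ᶠ y' in 𝓝 y, (x, y') ∈ Ω :=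
  (Continuous.tendsto (by fun_prop : Continuous fun y' : ℝ => (x, y')) y) (hΩ.mem_nhds h)

include hΩ in
lemma Dx_congr {u v} (h : EqR Ω u v) : EqR Ω (Dx u) (Dx v) := by
  intro x y hz
  apply Filter.EventuallyEq.deriv_eq
  filter_upwards [evx hΩ hz] with x' hx'
  exact h _ _ hx'
include hΩ in
lemma Dy_congr {u v} (h : EqR Ω u v) : EqR Ω (Dy u) (Dy v) := by
  intro x y hz
  apply Filter.EventuallyEq.deriv_eq
  filter_upwards [evy hΩ hz] with x' hx'
  exact h _ _ hx'
include hΩ in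
lemma Dxn_congr {u v} (h : EqR Ω u v) (n : ℕ) : EqR Ω (Dx^[n] u) (Dx^[n] v) := by
  induction n with
  | zero => simpa using h
  | succ n ih => rw [Function.iterate_succ_apply', Function.iterate_succ_apply']; exact Dx_congr hΩ ih

include hΩ in
lemma Sm.diff {u} (hu : Sm Ω u) {x y} (h : (x, y) ∈ Ω) :
    HasFDerivAt (fun z : ℝ × ℝ => u z.1 z.2) (fderiv ℝ (fun z : ℝ × ℝ => u z.1 z.2) (x, y)) (x, y) :=
  ((hu.contDiffAt (hΩ.mem_nhds h)).differentiableAt (by simp)).hasFDerivAt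

include hΩ in
lemma Sm.hx' {u} (hu : Sm Ω u) {x y} (h : (x, y) ∈ Ω) :
    HasDerivAt (fun x' => u x' y) (fderiv ℝ (fun z : ℝ × ℝ => u z.1 z.2) (x, y) (1, 0)) x := by
  have := (hu.diff hΩ h).comp_hasDerivAt x
    ((hasDerivAt_id x).prodMk (hasDerivAt_const x y))
  exact this
include hΩ in
lemma Sm.hy' {u} (hu : Sm Ω u) {x y} (h : (x, y) ∈ Ω) :
    HasDerivAt (u x) (fderiv ℝ (fun z : ℝ × ℝ => u z.1 z.2) (x, y) (0, 1)) y := by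
  have := (hu.diff hΩ h).comp_hasDerivAt y
    ((hasDerivAt_const y x).prodMk (hasDerivAt_id y))
  exact this
include hΩ in
lemma Sm.hx {u} (hu : Sm Ω u) {x y} (h : (x, y) ∈ Ω) :
    HasDerivAt (fun x' => u x' y) (Dx u x y) x := (hu.hx' hΩ h).differentiableAt.hasDerivAt
include hΩ in
lemma Sm.hy {u} (hu : Sm Ω u) {x y} (h : (x, y) ∈ Ω) :
    HasDerivAt (u x) (Dy u x y) y := (hu.hy' hΩ h).differentiableAt.hasDerivAt

include hΩ in
lemma Sm.Dx_eq {u} (hu : Sm Ω u) {x y} (h : (x, y) ∈ Ω) :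
    Dx u x y = fderiv ℝ (fun z : ℝ × ℝ => u z.1 z.2) (x, y) (1, 0) := (hu.hx' hΩ h).deriv
include hΩ in
lemma Sm.Dy_eq {u} (hu : Sm Ω u) {x y} (h : (x, y) ∈ Ω) :
    Dy u x y = fderiv ℝ (fun z : ℝ × ℝ => u z.1 z.2) (x, y) (0, 1) := (hu.hy' hΩ h).deriv

include hΩ in
lemma Sm.dx {u} (hu : Sm Ω u) : Sm Ω (Dx u) := by
  have h1 : ContDiffOn ℝ ∞ (fderiv ℝ (fun z : ℝ × ℝ => u z.1 z.2)) Ω :=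
    ContDiffOn.fderiv_of_isOpen hu hΩ (by simp)
  exact (h1.clm_apply (contDiffOn_const (c := ((1 : ℝ), (0 : ℝ))))).congr
    (fun z hz => hu.Dx_eq hΩ hz)
include hΩ in
lemma Sm.dy {u} (hu : Sm Ω u) : Sm Ω (Dy u) := by
  have h1 : ContDiffOn ℝ ∞ (fderiv ℝ (fun z : ℝ × ℝ => u z.1 z.2)) Ω :=
    ContDiffOn.fderiv_of_isOpen hu hΩ (by simp)
  exact (h1.clm_apply (contDiffOn_const (c := ((0 : ℝ), (1 : ℝ))))).congr
    (fun z hz => hu.Dy_eq hΩ hz)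
include hΩ in
lemma Sm.dxn {u} (hu : Sm Ω u) (n : ℕ) : Sm Ω (Dx^[n] u) := by
  induction n with
  | zero => simpa using hu
  | succ n ih => rw [Function.iterate_succ_apply']; exact ih.dx hΩ

include hΩ in
lemma Sm.comm {u} (hu : Sm Ω u) : EqR Ω (Dx (Dy u)) (Dy (Dx u)) := by
  intro x y h
  have h1 : ContDiffOn ℝ ∞ (fderiv ℝ (fun z : ℝ × ℝ => u z.1 z.2)) Ω :=
    ContDiffOn.fderiv_of_isOpen hu hΩ (by simp)
  have hd : DifferentiableAt ℝ (fderiv ℝ (fun z : ℝ × ℝ => u z.1 z.2)) (x, y) :=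
    (h1.contDiffAt (hΩ.mem_nhds h)).differentiableAt (by simp)
  have key : ∀ a b : ℝ × ℝ, fderiv ℝ (fun z => fderiv ℝ (fun z : ℝ × ℝ => u z.1 z.2) z a) (x, y) b
      = fderiv ℝ (fderiv ℝ (fun z : ℝ × ℝ => u z.1 z.2)) (x, y) b a := by
    intro a b
    rw [fderiv_clm_apply hd (differentiableAt_const a)]
    simp
  have e1 : (fun z : ℝ × ℝ => Dy u z.1 z.2) =ᶠ[𝓝 (x, y)]
      fun z => fderiv ℝ (fun z : ℝ × ℝ => u z.1 z.2) z (0, 1) := by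
    filter_upwards [hΩ.mem_nhds h] with z hz
    exact hu.Dy_eq hΩ hz
  have e2 : (fun z : ℝ × ℝ => Dx u z.1 z.2) =ᶠ[𝓝 (x, y)]
      fun z => fderiv ℝ (fun z : ℝ × ℝ => u z.1 z.2) z (1, 0) := by
    filter_upwards [hΩ.mem_nhds h] with z hz
    exact hu.Dx_eq hΩ hz
  rw [(hu.dy hΩ).Dx_eq hΩ h, (hu.dx hΩ).Dy_eq hΩ h, e1.fderiv_eq, e2.fderiv_eq, key, key]
  exact ((hu.contDiffAt (hΩ.mem_nhds h)).isSymmSndFDerivAt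
    (by rw [minSmoothness_of_isRCLikeNormedField]; exact WithTop.coe_le_coe.2 le_top)) (1, 0) (0, 1)

include hΩ in
lemma Sm.commn {u} (hu : Sm Ω u) (n : ℕ) : EqR Ω (Dx^[n] (Dy u)) (Dy (Dx^[n] u)) := by
  induction n with
  | zero => intro x y _; rfl
  | succ n ih =>
    rw [Function.iterate_succ_apply', Function.iterate_succ_apply']
    intro x y h
    rw [Dx_congr hΩ ih x y h, (hu.dxn hΩ n).comm hΩ x y h]

include hΩ in
lemma Dx_mul {u v} (hu : Sm Ω u) (hv : Sm Ω v) :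
    EqR Ω (Dx (fun x y => u x y * v x y)) (fun x y => Dx u x y * v x y + u x y * Dx v x y) :=
  fun _ _ h => ((hu.hx hΩ h).mul (hv.hx hΩ h)).deriv
include hΩ in
lemma Dy_mul {u v} (hu : Sm Ω u) (hv : Sm Ω v) :
    EqR Ω (Dy (fun x y => u x y * v x y)) (fun x y => Dy u x y * v x y + u x y * Dy v x y) :=
  fun _ _ h => ((hu.hy hΩ h).mul (hv.hy hΩ h)).deriv
include hΩ in
lemma Dx_add {u v} (hu : Sm Ω u) (hv : Sm Ω v) :
    EqR Ω (Dx (fun x y => u x y + v x y)) (fun x y => Dx u x y + Dx v x y) :=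
  fun _ _ h => ((hu.hx hΩ h).add (hv.hx hΩ h)).deriv
include hΩ in
lemma Dy_add {u v} (hu : Sm Ω u) (hv : Sm Ω v) :
    EqR Ω (Dy (fun x y => u x y + v x y)) (fun x y => Dy u x y + Dy v x y) :=
  fun _ _ h => ((hu.hy hΩ h).add (hv.hy hΩ h)).deriv

def Bd (Ω : Set (ℝ × ℝ)) (r : ℝ) (u : ℝ → ℝ → ℝ) : Prop :=
  ∃ C : ℝ, 0 ≤ C ∧ ∀ x y, (x, y) ∈ Ω → |u x y| ≤ C * y ^ r

lemma Bd.mono {Ω' : Set (ℝ × ℝ)} (h : Ω' ⊆ Ω) {u r} (hu : Bd Ω r u) : Bd Ω' r u := by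
  obtain ⟨C, hC, h1⟩ := hu
  exact ⟨C, hC, fun x y hz => h1 x y (h hz)⟩
lemma Bd.congr {u v r} (hu : Bd Ω r u) (h : EqR Ω v u) : Bd Ω r v := by
  obtain ⟨C, hC, h1⟩ := hu
  exact ⟨C, hC, fun x y hz => by rw [h x y hz]; exact h1 x y hz⟩
lemma Bd.add {u v r} (hu : Bd Ω r u) (hv : Bd Ω r v) : Bd Ω r (fun x y => u x y + v x y) := by
  obtain ⟨C, hC, h1⟩ := hu
  obtain ⟨D, hD, h2⟩ := hv
  refine ⟨C + D, by positivity, fun x y hz => ?_⟩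
  have := abs_add_le (u x y) (v x y)
  have := h1 x y hz
  have := h2 x y hz
  linarith
variable (hp : ∀ x y, (x, y) ∈ Ω → 0 < y ∧ y < 1)
include hp in
lemma Bd.mul {u v r s t} (hu : Bd Ω r u) (hv : Bd Ω s v) (ht : r + s = t) :
    Bd Ω t (fun x y => u x y * v x y) := by
  obtain ⟨C, hC, h1⟩ := hu
  obtain ⟨D, hD, h2⟩ := hv
  refine ⟨C * D, by positivity, fun x y hz => ?_⟩
  rw [abs_mul, ← ht, Real.rpow_add (hp x y hz).1]
  calc |u x y| * |v x y| ≤ (C * y ^ r) * (D * y ^ s) :=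
        mul_le_mul (h1 x y hz) (h2 x y hz) (abs_nonneg _) (le_trans (abs_nonneg _) (h1 x y hz))
    _ = _ := by ring
include hp in
lemma Bd.weak {u r s} (hu : Bd Ω r u) (h : s ≤ r) : Bd Ω s u := by
  obtain ⟨C, hC, h1⟩ := hu
  refine ⟨C, hC, fun x y hz => (h1 x y hz).trans ?_⟩
  exact mul_le_mul_of_nonneg_left
    (Real.rpow_le_rpow_of_exponent_ge (hp x y hz).1 (hp x y hz).2.le h) hC
lemma Bd.cmul {u r} (hu : Bd Ω r u) (c : ℝ) : Bd Ω r (fun x y => c * u x y) := by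
  obtain ⟨C, hC, h1⟩ := hu
  refine ⟨|c| * C, by positivity, fun x y hz => ?_⟩
  rw [abs_mul, mul_assoc]
  exact mul_le_mul_of_nonneg_left (h1 x y hz) (abs_nonneg c)

def Cl (Ω : Set (ℝ × ℝ)) : ℕ → ℝ → (ℝ → ℝ → ℝ) → Prop
  | 0, r, u => Sm Ω u ∧ Bd Ω r u ∧ Bd Ω (r - 1) (Dy u)
  | n + 1, r, u => (Sm Ω u ∧ Bd Ω r u ∧ Bd Ω (r - 1) (Dy u)) ∧ Cl Ω n r (Dx u)

lemma Cl.base {n r u} (h : Cl Ω n r u) : Sm Ω u ∧ Bd Ω r u ∧ Bd Ω (r - 1) (Dy u) := by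
  cases n with
  | zero => exact h
  | succ n => exact h.1
lemma Cl.sm {n r u} (h : Cl Ω n r u) : Sm Ω u := h.base.1
lemma Cl.bd {n r u} (h : Cl Ω n r u) : Bd Ω r u := h.base.2.1
lemma Cl.bdy {n r u} (h : Cl Ω n r u) : Bd Ω (r - 1) (Dy u) := h.base.2.2

lemma Cl.down1 {n} : ∀ {r u}, Cl Ω (n + 1) r u → Cl Ω n r u := by
  induction n with
  | zero => intro r u h; exact h.1
  | succ n ih => intro r u h; exact ⟨h.1, ih h.2⟩
lemma Cl.down {m n r u} (h : Cl Ω n r u) (hm : m ≤ n) : Cl Ω m r u := by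
  induction n, hm using Nat.le_induction with
  | base => exact h
  | succ n _ ih => exact ih h.down1
lemma Cl.dx {n r u} (h : Cl Ω (n + 1) r u) : Cl Ω n r (Dx u) := h.2
lemma Cl.dxn {n r} (j : ℕ) : ∀ {u}, Cl Ω (n + j) r u → Cl Ω n r (Dx^[j] u) := by
  induction j with
  | zero => intro u h; exact h
  | succ j ih => intro u h; rw [Function.iterate_succ_apply]; exact ih h.dx

lemma Cl.mono {Ω' : Set (ℝ × ℝ)} (h : Ω' ⊆ Ω) {n} :
    ∀ {r u}, Cl Ω n r u → Cl Ω' n r u := by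
  induction n with
  | zero => intro r u hu; exact ⟨hu.1.mono h, hu.2.1.mono h, hu.2.2.mono h⟩
  | succ n ih => intro r u hu; exact ⟨⟨hu.1.1.mono h, hu.1.2.1.mono h, hu.1.2.2.mono h⟩, ih hu.2⟩

include hΩ in
lemma Cl.congr {n} : ∀ {r u v}, Cl Ω n r u → EqR Ω v u → Cl Ω n r v := by
  induction n with
  | zero => intro r u v h e; exact ⟨h.1.congr e, h.2.1.congr e, h.2.2.congr (Dy_congr hΩ e)⟩
  | succ n ih =>
    intro r u v h e
    exact ⟨⟨h.1.1.congr e, h.1.2.1.congr e, h.1.2.2.congr (Dy_congr hΩ e)⟩, ih h.2 (Dx_congr hΩ e)⟩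

include hΩ in
lemma Cl.add {n} : ∀ {r u v}, Cl Ω n r u → Cl Ω n r v → Cl Ω n r (fun x y => u x y + v x y) := by
  have base : ∀ {r u v}, Cl Ω 0 r u → Cl Ω 0 r v → Cl Ω 0 r (fun x y => u x y + v x y) :=
    fun hu hv => ⟨hu.1.add hv.1, hu.2.1.add hv.2.1, (hu.2.2.add hv.2.2).congr (Dy_add hΩ hu.1 hv.1)⟩
  induction n with
  | zero => exact base
  | succ n ih =>
    intro r u v hu hv
    exact ⟨base hu.1 hv.1, (ih hu.2 hv.2).congr hΩ (Dx_add hΩ hu.1.1 hv.1.1)⟩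

include hΩ hp in
lemma Cl.mul {n} : ∀ {r s t u v}, Cl Ω n r u → Cl Ω n s v → r + s = t →
    Cl Ω n t (fun x y => u x y * v x y) := by
  have base : ∀ {r s t u v}, Cl Ω 0 r u → Cl Ω 0 s v → r + s = t →
      Cl Ω 0 t (fun x y => u x y * v x y) :=
    fun hu hv ht => ⟨hu.1.mul hv.1, hu.2.1.mul hp hv.2.1 ht,
      ((hu.2.2.mul hp hv.2.1 (by linarith)).add (hu.2.1.mul hp hv.2.2 (by linarith))).congr
        (Dy_mul hΩ hu.1 hv.1)⟩
  induction n with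
  | zero => exact base
  | succ n ih =>
    intro r s t u v hu hv ht
    exact ⟨base hu.1 hv.1 ht, ((ih hu.2 hv.down1 ht).add hΩ (ih hu.down1 hv.2 ht)).congr hΩ
      (Dx_mul hΩ hu.1.1 hv.1.1)⟩

include hp in
lemma Cl.weak {n} : ∀ {r s u}, Cl Ω n r u → s ≤ r → Cl Ω n s u := by
  induction n with
  | zero => intro r s u h e; exact ⟨h.1, h.2.1.weak hp e, h.2.2.weak hp (by linarith)⟩
  | succ n ih =>
    intro r s u h e
    exact ⟨⟨h.1.1, h.1.2.1.weak hp e, h.1.2.2.weak hp (by linarith)⟩, ih h.2 e⟩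

lemma Cl_zero {n} : ∀ {r}, Cl Ω n r (fun _ _ => 0) := by
  have e1 : Dx (fun _ _ => (0 : ℝ)) = fun _ _ => 0 := by funext x y; simp [Dx]
  have e2 : Dy (fun _ _ => (0 : ℝ)) = fun _ _ => 0 := by funext x y; simp [Dy]
  have b : ∀ r, Bd Ω r (fun _ _ => 0) := fun r => ⟨0, le_rfl, by simp⟩
  have s : Sm Ω (fun _ _ => (0 : ℝ)) := contDiffOn_const
  induction n with
  | zero => intro r; exact ⟨s, b _, by rw [e2]; exact b _⟩
  | succ n ih => intro r; exact ⟨⟨s, b _, by rw [e2]; exact b _⟩, by rw [e1]; exact ih⟩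

/-- functions of `x` only -/
lemma Cl_fx {l X : ℝ} (hl : ∀ x y, (x, y) ∈ Ω → x ∈ Icc l X) {n} :
    ∀ {P : ℝ → ℝ}, ContDiff ℝ ∞ P → Cl Ω n 0 (fun x _ => P x) := by
  have base : ∀ {P : ℝ → ℝ}, ContDiff ℝ ∞ P → Cl Ω 0 0 (fun x _ => P x) := by
    intro P hP
    refine ⟨(hP.comp contDiff_fst).contDiffOn, ?_, ?_⟩
    · obtain ⟨C, hC⟩ := (isCompact_Icc (a := l) (b := X)).exists_bound_of_continuousOn
        (hP.continuous.continuousOn)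
      refine ⟨max C 0, le_max_right _ _, fun x y hz => ?_⟩
      have := hC x (hl x y hz)
      rw [Real.rpow_zero, mul_one]
      exact le_trans this (le_max_left _ _)
    · refine ⟨0, le_rfl, fun x y hz => ?_⟩
      simp [Dy]
  induction n with
  | zero => exact base
  | succ n ih =>
    intro P hP
    refine ⟨base hP, ?_⟩
    have h2 : ContDiff ℝ ∞ (deriv P) := (contDiff_infty_iff_deriv.1 hP).2
    exact ih h2

lemma Cl_const {n} (c : ℝ) : Cl Ω n 0 (fun _ _ => c) := by
  have e2 : Dy (fun _ _ => (c : ℝ)) = fun _ _ => 0 := by funext x y; simp [Dy]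
  have e1 : Dx (fun _ _ => (c : ℝ)) = fun _ _ => 0 := by funext x y; simp [Dx]
  have b : Cl Ω 0 0 (fun _ _ => c) := by
    refine ⟨contDiffOn_const, ⟨|c|, abs_nonneg c, by simp⟩, ?_⟩
    rw [e2]; exact (Cl_zero (n := 0)).2.1
  cases n with
  | zero => exact b
  | succ n => exact ⟨b, by rw [e1]; exact Cl_zero⟩

include hΩ hp in
lemma Cl.cmul {n r u} (hu : Cl Ω n r u) (c : ℝ) : Cl Ω n r (fun x y => c * u x y) :=
  (Cl_const c).mul hΩ hp hu (by ring)

end basic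


noncomputable def bb (w : ℝ → ℝ → ℝ) : ℝ → ℝ → ℝ := fun x y => (√(w x y))⁻¹
noncomputable def c3 (w : ℝ → ℝ → ℝ) : ℝ → ℝ → ℝ := fun x y => bb w x y * (bb w x y * bb w x y)
noncomputable def EE (w : ℝ → ℝ → ℝ) (P : ℝ → ℝ) (n : ℕ) : ℝ → ℝ → ℝ :=
  fun x y => -1 * (c3 w x y * (P x + ((n : ℝ) + 1) / 2 * Dx w x y))
noncomputable def SS (w : ℝ → ℝ → ℝ) (P : ℝ → ℝ) : ℕ → ℝ → ℝ → ℝ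
  | 0 => fun x y => 2 * (bb w x y * deriv P x) + 1 / 2 * (c3 w x y * (Dx w x y * Dx w x y))
  | n + 1 => fun x y => Dx (SS w P n) x y + Dx (EE w P (n + 1)) x y * Dx^[n + 1] w x y

section eqns
variable {Ω : Set (ℝ × ℝ)} (hΩ : IsOpen Ω) (hp : ∀ x y, (x, y) ∈ Ω → 0 < y ∧ y < 1)
  {w : ℝ → ℝ → ℝ} {P : ℝ → ℝ} {m : ℝ} (hm : 0 < m) (hw : Sm Ω w)
  (hwm : ∀ x y, (x, y) ∈ Ω → m * y ≤ w x y)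

lemma Sm_fx (hP : ContDiff ℝ ∞ P) : Sm Ω (fun x _ => P x) :=
  (hP.comp contDiff_fst).contDiffOn

include hp hm hwm in
lemma w_pos {x y} (h : (x, y) ∈ Ω) : 0 < w x y :=
  lt_of_lt_of_le (mul_pos hm (hp x y h).1) (hwm x y h)

include hp hm hw hwm in
lemma bb_sm : Sm Ω (bb w) := by
  refine ContDiffOn.inv (ContDiffOn.sqrt hw fun z hz => ?_) fun z hz => ?_
  · exact (w_pos hp hm hwm hz).ne'
  · exact (Real.sqrt_pos.2 (w_pos hp hm hwm hz)).ne'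

include hp hm hw hwm in
lemma c3_sm : Sm Ω (c3 w) :=
  (bb_sm hp hm hw hwm).mul ((bb_sm hp hm hw hwm).mul (bb_sm hp hm hw hwm))

lemma bb_aux {a : ℝ} (ha : 0 < a) (d : ℝ) :
    -(d / (2 * √a)) / √a ^ 2 = -(1 / 2) * ((√a)⁻¹ * ((√a)⁻¹ * (√a)⁻¹) * d) := by
  have : √a ≠ 0 := (Real.sqrt_pos.2 ha).ne'
  field_simp

include hΩ hp hm hw hwm in
lemma bb_dx : EqR Ω (Dx (bb w)) (fun x y => -(1 / 2) * (c3 w x y * Dx w x y)) := by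
  intro x y h
  have h0 := w_pos hp hm hwm h
  have := (((hw.hx hΩ h).sqrt h0.ne').inv (Real.sqrt_pos.2 h0).ne').deriv
  rw [bb_aux h0] at this
  exact this
include hΩ hp hm hw hwm in
lemma bb_dy : EqR Ω (Dy (bb w)) (fun x y => -(1 / 2) * (c3 w x y * Dy w x y)) := by
  intro x y h
  have h0 := w_pos hp hm hwm h
  have := (((hw.hy hΩ h).sqrt h0.ne').inv (Real.sqrt_pos.2 h0).ne').deriv
  rw [bb_aux h0] at this
  exact this

include hp hm hwm in
lemma bb_bd : Bd Ω (-1 / 2) (bb w) := by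
  refine ⟨(√m)⁻¹, by positivity, fun x y h => ?_⟩
  have hy := (hp x y h).1
  have h1 : √(m * y) ≤ √(w x y) := Real.sqrt_le_sqrt (hwm x y h)
  have h2 : y ^ (-1 / 2 : ℝ) = (√y)⁻¹ := by
    rw [Real.sqrt_eq_rpow, ← Real.rpow_neg hy.le]; norm_num
  rw [h2, ← mul_inv, ← Real.sqrt_mul hm.le, bb, abs_of_nonneg (by positivity)]
  exact inv_anti₀ (Real.sqrt_pos.2 (mul_pos hm hy)) h1

include hΩ hp hm hwm in
lemma bb_cl {n} (h : Cl Ω n 1 w) : Cl Ω n (-1 / 2) (bb w) := by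
  have hw := h.sm
  have hbd := bb_bd hp hm hwm
  have base : Cl Ω 0 (-1 / 2) (bb w) := by
    refine ⟨bb_sm hp hm hw hwm, hbd, ?_⟩
    exact ((((hbd.mul hp (hbd.mul hp hbd rfl) rfl).mul hp h.bdy rfl).weak hp (by norm_num)).cmul _).congr
      (bb_dy hΩ hp hm hw hwm)
  induction n with
  | zero => exact base
  | succ n ih =>
    refine ⟨base, ?_⟩
    have hb := ih h.down1
    exact ((((hb.mul hΩ hp (hb.mul hΩ hp hb rfl) rfl).mul hΩ hp h.dx (by norm_num))).cmul hΩ hp _).congr hΩ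
      (bb_dx hΩ hp hm hw hwm)

include hΩ hp hm hwm in
lemma c3_cl {n} (h : Cl Ω n 1 w) : Cl Ω n (-3 / 2) (c3 w) := by
  have hb := bb_cl hΩ hp hm hwm h
  exact hb.mul hΩ hp (hb.mul hΩ hp hb rfl) (by norm_num)

variable {l X : ℝ} (hl : ∀ x y, (x, y) ∈ Ω → x ∈ Icc l X) (hP : ContDiff ℝ ∞ P)

include hP in
lemma dP_smooth : ContDiff ℝ ∞ (deriv P) := (contDiff_infty_iff_deriv.1 hP).2

include hΩ hp hm hwm hl hP in
lemma EE_cl {m n} (h : Cl Ω (m + 1) 1 w) : Cl Ω m (-3 / 2) (EE w P n) := by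
  refine Cl.cmul hΩ hp ?_ _
  refine (c3_cl hΩ hp hm hwm h.down1).mul hΩ hp (s := 0) ?_ (by norm_num)
  exact (Cl_fx hl hP).add hΩ ((h.dx.cmul hΩ hp _).weak hp (by norm_num))

include hΩ hp hm hw hwm in
lemma EE_succ (n : ℕ) : EqR Ω (EE w P (n + 1)) (fun x y => EE w P n x y + Dx (bb w) x y) := by
  intro x y h
  beta_reduce
  rw [bb_dx hΩ hp hm hw hwm x y h]
  simp only [EE]; push_cast; ring

include hΩ hp hm hw hwm hP in
lemma EE_sm (n : ℕ) : Sm Ω (EE w P n) := by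
  refine Sm.mul contDiffOn_const (Sm.mul (c3_sm hp hm hw hwm) ((Sm_fx hP).add
    (Sm.mul contDiffOn_const (hw.dx hΩ))))

include hΩ hp hm hw hwm hP in
lemma SS_sm (n : ℕ) : Sm Ω (SS w P n) := by
  induction n with
  | zero =>
    exact Sm.add (Sm.mul contDiffOn_const ((bb_sm hp hm hw hwm).mul (Sm_fx (dP_smooth hP))))
      (Sm.mul contDiffOn_const ((c3_sm hp hm hw hwm).mul ((hw.dx hΩ).mul (hw.dx hΩ))))
  | succ n ih =>
    exact (ih.dx hΩ).add (((EE_sm hΩ hp hm hw hwm hP (n + 1)).dx hΩ).mul (hw.dxn hΩ _))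

include hΩ hp hm hw hwm hP in
lemma eq_n (n : ℕ) : EqR Ω (Dx^[n + 1] (fun x y => bb w x y * (Dx w x y + 2 * P x)))
    (fun x y => bb w x y * Dx^[n + 2] w x y + EE w P (n + 1) x y * Dx^[n + 1] w x y
      + SS w P n x y) := by
  have hb := bb_sm hp hm hw hwm
  induction n with
  | zero =>
    intro x y h
    have h1 := (hb.hx hΩ h).mul (((hw.dx hΩ).hx hΩ h).add
      ((hP.differentiable (by simp) x).hasDerivAt.const_mul 2))
    refine h1.deriv.trans ?_
    rw [bb_dx hΩ hp hm hw hwm x y h]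
    simp only [EE, SS, Function.iterate_succ, Function.iterate_zero, Function.comp, id, Pi.add_apply]
    push_cast; ring
  | succ n ih =>
    intro x y h
    rw [Function.iterate_succ_apply', Dx_congr hΩ ih x y h]
    have h1 := (((hb.hx hΩ h).mul ((hw.dxn hΩ (n + 2)).hx hΩ h)).add
      (((EE_sm hΩ hp hm hw hwm hP (n + 1)).hx hΩ h).mul ((hw.dxn hΩ (n + 1)).hx hΩ h))).add
      ((SS_sm hΩ hp hm hw hwm hP n).hx hΩ h)
    refine h1.deriv.trans ?_
    beta_reduce
    rw [EE_succ hΩ hp hm hw hwm (n + 1) x y h]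
    simp only [← Function.iterate_succ_apply' Dx, SS, Nat.succ_eq_add_one]
    rw [show n + 1 + 1 = n + 2 from rfl, show n + 1 + 2 = n + 2 + 1 from rfl]
    ring

include hΩ hp hm hw hwm hP in
lemma SS_one : EqR Ω (SS w P 1) (fun x y => (2 * (Dx (bb w) x y * deriv P x)
    + 2 * (bb w x y * deriv (deriv P) x))
    + (1 / 2 * (Dx (c3 w) x y * (Dx w x y * Dx w x y))
    + -1 * ((Dx (c3 w) x y * (P x + Dx w x y) + c3 w x y * deriv P x) * Dx w x y))) := by
  intro x y h
  have hb := (bb_sm hp hm hw hwm).hx hΩ h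
  have hc := (c3_sm hp hm hw hwm).hx hΩ h
  have hwx := (hw.dx hΩ).hx hΩ h
  have hPx := (hP.differentiable (by simp) x).hasDerivAt
  have hPx' := ((dP_smooth hP).differentiable (by simp) x).hasDerivAt
  have h1 : Dx (SS w P 0) x y = _ := (((hb.mul hPx').const_mul 2).add ((hc.mul (hwx.mul hwx)).const_mul (1 / 2))).deriv
  have h2 : Dx (EE w P (0 + 1)) x y = _ :=
    ((hc.mul (hPx.add (hwx.const_mul ((((0 + 1 : ℕ) : ℝ) + 1) / 2)))).const_mul (-1)).deriv
  change Dx (SS w P 0) x y + Dx (EE w P (0 + 1)) x y * Dx w x y = _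
  rw [h1, h2]
  push_cast
  simp only [Pi.mul_apply, Pi.add_apply]
  ring

include hΩ hp hm hwm hl hP in
lemma SS_cl (n : ℕ) : ∀ k, Cl Ω (k + (n + 1)) 1 w → Cl Ω k (-1 / 2) (SS w P (n + 1)) := by
  induction n with
  | zero =>
    intro k h
    have hb := bb_cl hΩ hp hm hwm h
    have hc := c3_cl hΩ hp hm hwm h
    have hdP : Cl Ω k 0 (fun x _ => deriv P x) := Cl_fx hl (dP_smooth hP)
    have hddP : Cl Ω k 0 (fun x _ => deriv (deriv P) x) := Cl_fx hl (dP_smooth (dP_smooth hP))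
    have hPP : Cl Ω k 0 (fun x _ => P x) := Cl_fx hl hP
    refine Cl.congr hΩ ?_ (SS_one hΩ hp hm h.sm hwm hP)
    refine ((((hb.dx.mul hΩ hp hdP (by norm_num)).cmul hΩ hp _)).add hΩ
      ((hb.down1.mul hΩ hp hddP (by norm_num)).cmul hΩ hp _)).add hΩ
      (((((hc.dx.mul hΩ hp (h.dx.mul hΩ hp h.dx rfl) rfl).weak hp (by norm_num)).cmul hΩ hp _)).add hΩ ?_)
    refine Cl.cmul hΩ hp ?_ _
    exact Cl.mul hΩ hp ((hc.dx.mul hΩ hp (hPP.add hΩ (h.dx.weak hp (by norm_num))) rfl).add hΩ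
      (hc.down1.mul hΩ hp hdP rfl)) h.dx (by norm_num)
  | succ n ih =>
    intro k h
    refine Cl.add hΩ (ih (k + 1) (h.down (by omega))).dx ?_
    exact (EE_cl hΩ hp hm hwm hl hP (h.down (by omega) : Cl Ω (k + 1 + 1) 1 w)).dx.mul hΩ hp
      (Cl.dxn (n + 1 + 1) h) (by norm_num)

end eqns


lemma second_deriv_nonpos {f f' : ℝ → ℝ} {y f'' : ℝ} (hmax : IsLocalMax f y)
    (h1 : ∀ᶠ z in 𝓝 y, HasDerivAt f (f' z) z) (h2 : HasDerivAt f' f'' y) : f'' ≤ 0 := by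
  by_contra! hpos
  have e1 : deriv f =ᶠ[𝓝 y] f' := by filter_upwards [h1] with z hz; exact hz.deriv
  have e2 : deriv (deriv f) y = f'' := by rw [e1.deriv_eq]; exact h2.deriv
  have hmin : IsLocalMin f y := isLocalMin_of_deriv_deriv_pos (by rw [e2]; exact hpos)
    hmax.deriv_eq_zero h1.self_of_nhds.continuousAt
  have hc : f =ᶠ[𝓝 y] fun _ => f y := by
    filter_upwards [hmin, hmax] with z h3 h4
    exact le_antisymm h4 h3
  have h5 : deriv f =ᶠ[𝓝 y] fun _ => 0 := by
    have := hc.deriv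
    simpa using this
  rw [h5.deriv_eq] at e2
  simp at e2
  linarith

lemma left_deriv_nonneg {f : ℝ → ℝ} {l x f' : ℝ} (hl : l < x) (hmax : ∀ z ∈ Icc l x, f z ≤ f x)
    (h : HasDerivAt f f' x) : 0 ≤ f' := by
  have h1 : Tendsto (slope f x) (𝓝[<] x) (𝓝 f') :=
    (hasDerivAt_iff_tendsto_slope.1 h).mono_left (nhdsWithin_mono _ (fun z hz => ne_of_lt hz))
  refine ge_of_tendsto h1 ?_
  filter_upwards [Ioo_mem_nhdsLT hl] with z hz
  rw [slope_def_field]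
  exact div_nonneg_of_nonpos (by linarith [hmax z ⟨hz.1.le, hz.2.le⟩]) (by linarith [hz.2])

/-- Maximum principle on a closed rectangle. -/
lemma max_principle {l X₂ y₁ y₂ : ℝ} (Z : ℝ → ℝ → ℝ)
    (hcont : ContinuousOn (fun z : ℝ × ℝ => Z z.1 z.2) (Icc l X₂ ×ˢ Icc y₁ y₂))
    (hl : ∀ y ∈ Icc y₁ y₂, Z l y ≤ 0)
    (h1 : ∀ x ∈ Icc l X₂, Z x y₁ ≤ 0) (h2 : ∀ x ∈ Icc l X₂, Z x y₂ ≤ 0)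
    (hin : ∀ x ∈ Ioc l X₂, ∀ y ∈ Ioo y₁ y₂, 0 < Z x y →
      ∃ (b zx zyy : ℝ) (Zy : ℝ → ℝ), 0 ≤ b ∧ HasDerivAt (fun x' => Z x' y) zx x ∧
        (∀ᶠ y' in 𝓝 y, HasDerivAt (Z x) (Zy y') y') ∧ HasDerivAt Zy zyy y ∧ b * zx - zyy < 0) :
    ∀ x ∈ Icc l X₂, ∀ y ∈ Icc y₁ y₂, Z x y ≤ 0 := by
  intro x hx y hy
  obtain ⟨⟨a, c⟩, ⟨ha, hc⟩, hmax⟩ := (isCompact_Icc.prod isCompact_Icc).exists_isMaxOn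
    ⟨(x, y), ⟨hx, hy⟩⟩ hcont
  simp only at ha hc
  have hmax' : ∀ x' ∈ Icc l X₂, ∀ y' ∈ Icc y₁ y₂, Z x' y' ≤ Z a c :=
    fun x' hx' y' hy' => hmax (show (x', y') ∈ Icc l X₂ ×ˢ Icc y₁ y₂ from ⟨hx', hy'⟩)
  refine (hmax' x hx y hy).trans ?_
  by_contra! hpos
  have a1 : l < a := lt_of_le_of_ne ha.1 (by rintro rfl; linarith [hl c hc])
  have c1 : y₁ < c := lt_of_le_of_ne hc.1 (by rintro rfl; linarith [h1 a ha])
  have c2 : c < y₂ := lt_of_le_of_ne hc.2 (by rintro rfl; linarith [h2 a ha])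
  obtain ⟨b, zx, zyy, Zy, hb, hzx, hzy, hzyy, hlt⟩ := hin a ⟨a1, ha.2⟩ c ⟨c1, c2⟩ hpos
  have e1 : 0 ≤ zx := left_deriv_nonneg a1
    (fun z hz => hmax' z ⟨hz.1, hz.2.trans ha.2⟩ c hc) hzx
  have e2 : zyy ≤ 0 := by
    refine second_deriv_nonpos (f := Z a) ?_ hzy hzyy
    filter_upwards [Ioo_mem_nhds c1 c2] with z hz
    exact hmax' a ha z ⟨hz.1.le, hz.2.le⟩
  nlinarith [mul_nonneg hb e1]

/-- Maximum principle with a limiting condition at `y = 0`. -/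
lemma max_principle0 {l X₂ d : ℝ} (Z : ℝ → ℝ → ℝ)
    (hcont : ContinuousOn (fun z : ℝ × ℝ => Z z.1 z.2) (Icc l X₂ ×ˢ Ioc 0 d))
    (hl : ∀ y ∈ Ioc 0 d, Z l y ≤ 0)
    (h1 : ∀ σ > 0, ∃ ρ > 0, ∀ x ∈ Icc l X₂, ∀ y ∈ Ioc 0 d, y ≤ ρ → Z x y ≤ σ)
    (h2 : ∀ x ∈ Icc l X₂, Z x d ≤ 0)
    (hin : ∀ x ∈ Ioc l X₂, ∀ y ∈ Ioo 0 d, 0 < Z x y →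
      ∃ (b zx zyy : ℝ) (Zy : ℝ → ℝ), 0 ≤ b ∧ HasDerivAt (fun x' => Z x' y) zx x ∧
        (∀ᶠ y' in 𝓝 y, HasDerivAt (Z x) (Zy y') y') ∧ HasDerivAt Zy zyy y ∧ b * zx - zyy < 0) :
    ∀ x ∈ Icc l X₂, ∀ y ∈ Ioc 0 d, Z x y ≤ 0 := by
  intro x hx y hy
  refine le_of_forall_pos_le_add fun σ hσ => ?_
  obtain ⟨ρ, hρ, hr⟩ := h1 σ hσ
  have hr0 : 0 < min ρ y := lt_min hρ hy.1
  have := max_principle (l := l) (X₂ := X₂) (y₁ := min ρ y) (y₂ := d) (fun x y => Z x y - σ)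
    ((hcont.mono (prod_mono le_rfl fun z hz => ⟨lt_of_lt_of_le hr0 hz.1, hz.2⟩)).sub continuousOn_const)
    (fun y' hy' => by linarith [hl y' ⟨lt_of_lt_of_le hr0 hy'.1, hy'.2⟩])
    (fun x' hx' => by linarith [hr x' hx' _ ⟨hr0, (min_le_right _ _).trans hy.2⟩ (min_le_left _ _)])
    (fun x' hx' => by linarith [h2 x' hx'])
    (fun x' hx' y' hy' hpos => by
      obtain ⟨b, zx, zyy, Zy, hb, hzx, hzy, hzyy, hlt⟩ :=
        hin x' hx' y' ⟨lt_trans hr0 hy'.1, hy'.2⟩ (by linarith)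
      exact ⟨b, zx, zyy, Zy, hb, hzx.sub_const σ,
        by filter_upwards [hzy] with z hz; exact hz.sub_const σ, hzyy, hlt⟩)
    x hx y ⟨min_le_right _ _, hy.2⟩
  linarith

/-- Barrier argument. -/
lemma barrier {Ω : Set (ℝ × ℝ)} (hΩ : IsOpen Ω) {l X₂ d A : ℝ}
    (hsub : Icc l X₂ ×ˢ Ioc 0 d ⊆ Ω) {u : ℝ → ℝ → ℝ} (hu : Sm Ω u)
    (b e E : ℝ → ℝ → ℝ) (B B' B'' : ℝ → ℝ)
    (hA : 0 ≤ A)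
    (hB : ∀ y ∈ Ioc 0 d, 0 ≤ B y)
    (hB1 : ∀ y ∈ Ioc 0 d, HasDerivAt B (B' y) y)
    (hB2 : ∀ y ∈ Ioc 0 d, HasDerivAt B' (B'' y) y)
    (hb : ∀ x ∈ Icc l X₂, ∀ y ∈ Ioc 0 d, 0 ≤ b x y)
    (he : ∀ x ∈ Icc l X₂, ∀ y ∈ Ioc 0 d, 0 ≤ e x y)
    (heq : ∀ x ∈ Icc l X₂, ∀ y ∈ Ioc 0 d,
      Dy (Dy u) x y = b x y * Dx u x y + e x y * u x y + E x y)
    (hE : ∀ x ∈ Icc l X₂, ∀ y ∈ Ioc 0 d,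
      b x y * |u x y| + (X₂ - l) * |E x y| < A * (- B'' y))
    (hd : ∀ x ∈ Icc l X₂, (X₂ - l) * |u x d| ≤ A * B d)
    (h0 : ∀ σ > 0, ∃ ρ > 0, ∀ x ∈ Icc l X₂, ∀ y ∈ Ioc 0 d, y ≤ ρ → (X₂ - l) * |u x y| ≤ σ) :
    ∀ x ∈ Icc l X₂, ∀ y ∈ Ioc 0 d, (x - l) * |u x y| ≤ A * B y := by
  have main : ∀ s : ℝ, |s| = 1 →
      ∀ x ∈ Icc l X₂, ∀ y ∈ Ioc 0 d, (x - l) * (s * u x y) - A * B y ≤ 0 := by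
    intro s hs
    have hsu : ∀ t, s * t ≤ |t| := fun t => by
      calc s * t ≤ |s * t| := le_abs_self _
        _ = |t| := by rw [abs_mul, hs, one_mul]
    have hxu : ∀ x ∈ Icc l X₂, ∀ t, (x - l) * (s * t) ≤ (X₂ - l) * |t| := fun x hx t =>
      (mul_le_mul_of_nonneg_left (hsu t) (by linarith [hx.1])).trans
        (mul_le_mul_of_nonneg_right (by linarith [hx.2]) (abs_nonneg t))
    refine max_principle0 (fun x y => (x - l) * (s * u x y) - A * B y) ?_ ?_ ?_ ?_ ?_
    · have c1 : ContinuousOn (fun z : ℝ × ℝ => u z.1 z.2) (Icc l X₂ ×ˢ Ioc 0 d) :=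
        (ContDiffOn.continuousOn hu).mono hsub
      have c2 : ContinuousOn B (Ioc 0 d) := fun y hy => (hB1 y hy).continuousAt.continuousWithinAt
      have c3 : ContinuousOn (fun z : ℝ × ℝ => B z.2) (Icc l X₂ ×ˢ Ioc 0 d) :=
        c2.comp continuousOn_snd (fun z hz => hz.2)
      exact ((continuousOn_fst.sub continuousOn_const).mul (continuousOn_const.mul c1)).sub
        (continuousOn_const.mul c3)
    · intro y hy
      have := mul_nonneg hA (hB y hy)
      simp only [sub_self, zero_mul]
      linarith
    · intro σ hσ
      obtain ⟨ρ, hρ, h⟩ := h0 σ hσ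
      refine ⟨ρ, hρ, fun x hx y hy hyρ => ?_⟩
      have := mul_nonneg hA (hB y hy)
      linarith [h x hx y hy hyρ, hxu x hx (u x y)]
    · intro x hx
      linarith [hd x hx, hxu x hx (u x d)]
    · intro x hx y hy hpos
      have hx' : x ∈ Icc l X₂ := ⟨hx.1.le, hx.2⟩
      have hy' : y ∈ Ioc 0 d := ⟨hy.1, hy.2.le⟩
      have hz : (x, y) ∈ Ω := hsub ⟨hx', hy'⟩
      refine ⟨b x y, s * u x y + (x - l) * (s * Dx u x y),
        (x - l) * (s * Dy (Dy u) x y) - A * B'' y,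
        fun y' => (x - l) * (s * Dy u x y') - A * B' y', hb x hx' y hy', ?_, ?_, ?_, ?_⟩
      · have := ((((hasDerivAt_id x).sub_const l).mul ((hu.hx hΩ hz).const_mul s))).sub_const (A * B y)
        simpa using this
      · filter_upwards [Ioo_mem_nhds hy.1 hy.2] with z hz'
        have hz'' : z ∈ Ioc 0 d := ⟨hz'.1, hz'.2.le⟩
        exact (((hu.hy hΩ (hsub ⟨hx', hz''⟩)).const_mul s).const_mul (x - l)).sub
          ((hB1 z hz'').const_mul A)
      · exact ((((hu.dy hΩ).hy hΩ hz).const_mul s).const_mul (x - l)).sub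
          ((hB2 y hy').const_mul A)
      · rw [heq x hx' y hy']
        have p1 := hE x hx' y hy'
        have p2 : 0 ≤ e x y * ((x - l) * (s * u x y)) := by
          refine mul_nonneg (he x hx' y hy') ?_
          have := mul_nonneg hA (hB y hy')
          linarith
        have p3 : b x y * (s * u x y) ≤ b x y * |u x y| :=
          mul_le_mul_of_nonneg_left (hsu _) (hb x hx' y hy')
        have p4 := hxu x hx' (- E x y)
        rw [abs_neg] at p4
        nlinarith
  intro x hx y hy
  have m1 := main 1 (by simp) x hx y hy
  have m2 := main (-1) (by simp) x hx y hy
  rcases abs_cases (u x y) with ⟨h, _⟩ | ⟨h, _⟩ <;> rw [h] <;> linarith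

lemma bern_alg {K R L q c c' v vy T b : ℝ} (hK : 0 ≤ K) (hL0 : 0 ≤ L) (hL : L ≤ R)
    (hq : 0 ≤ q) (hc0 : 0 ≤ c) (hc : c ≤ 1) (hc' : |c'| ≤ q) (hb : b ≤ K * q ^ 2)
    (hT : |T| ≤ K * q ^ 2 * (1 + |v|) + K * q * |vy|) :
    2 * b * L * c ^ 2 * v ^ 2 + L ^ 2 * (2 * c ^ 2 * v * T - (2 * c' ^ 2 + 2 * c * (-2 * q ^ 2)) * v ^ 2
      - 8 * c * c' * v * vy - 2 * c ^ 2 * vy ^ 2)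
    ≤ q ^ 2 * ((2 * K * R + R ^ 2 * (3 * K + K ^ 2 + 20)) * v ^ 2 + R ^ 2 * K) := by
  have hc2 : c ^ 2 ≤ 1 := pow_le_one₀ hc0 hc
  have hR : 0 ≤ R := hL0.trans hL
  have hL2 : L ^ 2 ≤ R ^ 2 := pow_le_pow_left₀ hL0 hL 2
  have hc'2 : c' ^ 2 ≤ q ^ 2 := sq_le_sq' (by linarith [abs_le.1 hc']) (abs_le.1 hc').2
  have t1 : 2 * b * L * c ^ 2 * v ^ 2 ≤ q ^ 2 * (2 * K * R) * v ^ 2 := by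
    have : b * (L * c ^ 2) ≤ K * q ^ 2 * (R * 1) :=
      mul_le_mul hb (mul_le_mul hL hc2 (by positivity) hR) (by positivity) (by positivity)
    nlinarith [sq_nonneg v]
  have t2 : 2 * c ^ 2 * v * T ≤ q ^ 2 * (K * (1 + 3 * v ^ 2) + K ^ 2 * v ^ 2) + c ^ 2 * vy ^ 2 := by
    have a1 : v * T ≤ |v| * (K * q ^ 2 * (1 + |v|) + K * q * |vy|) := by
      calc v * T ≤ |v * T| := le_abs_self _
        _ = |v| * |T| := abs_mul _ _
        _ ≤ _ := mul_le_mul_of_nonneg_left hT (abs_nonneg v)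
    have a2 : 2 * (|v| * (K * q ^ 2 * (1 + |v|) + K * q * |vy|)) ≤
        q ^ 2 * (K * (1 + 3 * v ^ 2) + K ^ 2 * v ^ 2) + vy ^ 2 := by
      rw [← sq_abs v, ← sq_abs vy]
      nlinarith [sq_nonneg (K * q * |v| - |vy|), mul_nonneg (mul_nonneg hK (sq_nonneg q)) (sq_nonneg (|v| - 1))]
    have a3 : c ^ 2 * (2 * (v * T)) ≤ c ^ 2 * (q ^ 2 * (K * (1 + 3 * v ^ 2) + K ^ 2 * v ^ 2) + vy ^ 2) :=
      mul_le_mul_of_nonneg_left (by linarith) (sq_nonneg c)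
    have a4 : 0 ≤ q ^ 2 * (K * (1 + 3 * v ^ 2) + K ^ 2 * v ^ 2) := by positivity
    nlinarith
  have t3 : - (2 * c' ^ 2 + 2 * c * (-2 * q ^ 2)) * v ^ 2 ≤ 4 * q ^ 2 * v ^ 2 := by
    have : c * q ^ 2 ≤ q ^ 2 := by nlinarith [sq_nonneg q]
    have h : - (2 * c' ^ 2 + 2 * c * (-2 * q ^ 2)) ≤ 4 * q ^ 2 := by nlinarith [sq_nonneg c']
    exact mul_le_mul_of_nonneg_right h (sq_nonneg v)
  have t4 : - (8 * c * c' * v * vy) ≤ c ^ 2 * vy ^ 2 + 16 * q ^ 2 * v ^ 2 := by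
    have := mul_le_mul_of_nonneg_right hc'2 (sq_nonneg v)
    nlinarith [sq_nonneg (c * vy + 4 * c' * v)]
  have t5 : 2 * c ^ 2 * v * T - (2 * c' ^ 2 + 2 * c * (-2 * q ^ 2)) * v ^ 2
      - 8 * c * c' * v * vy - 2 * c ^ 2 * vy ^ 2 ≤ q ^ 2 * ((3 * K + K ^ 2 + 20) * v ^ 2 + K) := by
    nlinarith
  have t6 := mul_le_mul_of_nonneg_left t5 (sq_nonneg L)
  have t7 : L ^ 2 * (q ^ 2 * ((3 * K + K ^ 2 + 20) * v ^ 2 + K)) ≤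
    R ^ 2 * (q ^ 2 * ((3 * K + K ^ 2 + 20) * v ^ 2 + K)) :=
    mul_le_mul_of_nonneg_right hL2 (by positivity)
  nlinarith

set_option maxHeartbeats 1000000 in
/-- Interior Bernstein estimate. -/
lemma bern_est (K κ R : ℝ) (hK : 0 ≤ K) (hκ : 0 < κ) (hR : 0 ≤ R) : ∃ C : ℝ, 0 ≤ C ∧
    ∀ (Ω : Set (ℝ × ℝ)) (l X₂ r : ℝ) (v U b : ℝ → ℝ → ℝ), IsOpen Ω → X₂ - l ≤ R → 0 < r →
      Icc l X₂ ×ˢ Icc (r / 2) (3 * r / 2) ⊆ Ω → Sm Ω v → Sm Ω U →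
      (∀ x y, (x, y) ∈ Icc l X₂ ×ˢ Icc (r / 2) (3 * r / 2) → 0 ≤ b x y ∧ b x y ≤ K * r⁻¹ ^ 2 ∧
        |b x y * Dx v x y - Dy (Dy v) x y| ≤ K * r⁻¹ ^ 2 * (1 + |v x y|) + K * r⁻¹ * |Dy v x y| ∧
        b x y * Dx U x y - Dy (Dy U) x y ≤ - κ * r⁻¹ ^ 2 * v x y ^ 2 + K * r⁻¹ ^ 2 ∧
        |U x y| ≤ K) →
      ∀ x ∈ Icc l X₂, (x - l) ^ 2 * v x r ^ 2 ≤ C := by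
  set C3 := 2 * K * R + R ^ 2 * (3 * K + K ^ 2 + 20) with hC3
  have hC3' : 0 ≤ C3 := by positivity
  set N := C3 / κ with hN
  have hN0 : 0 ≤ N := by positivity
  set C2 := R ^ 2 * K + N * K with hC2
  have hC2' : 0 ≤ C2 := by positivity
  refine ⟨16 * (2 * N * K + C2 + 1), by positivity, ?_⟩
  intro Ω l X₂ r v U b hΩ hXR hr hsub hv hU H x hx
  have hq : 0 < r⁻¹ := inv_pos.2 hr
  set q := r⁻¹ with hqdef
  have hrq : r * q = 1 := mul_inv_cancel₀ hr.ne'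
  have hrq2 : r ^ 2 * q ^ 2 = 1 := by rw [← mul_pow, hrq, one_pow]
  let c : ℝ → ℝ := fun y => (y - r / 2) * (3 * r / 2 - y) * q ^ 2
  let c' : ℝ → ℝ := fun y => (2 * r - 2 * y) * q ^ 2
  have hcd : ∀ y, HasDerivAt c (c' y) y := by
    intro y
    have := (((hasDerivAt_id y).sub_const (r / 2)).mul ((hasDerivAt_id y).const_sub (3 * r / 2))).mul_const (q ^ 2)
    refine HasDerivAt.congr_deriv this ?_
    simp only [c', id]; ring
  have hcd' : ∀ y, HasDerivAt c' (-2 * q ^ 2) y := by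
    intro y
    have := (((hasDerivAt_id y).const_mul 2).const_sub (2 * r)).mul_const (q ^ 2)
    refine HasDerivAt.congr_deriv this ?_
    ring
  let Z : ℝ → ℝ → ℝ := fun x y => (x - l) ^ 2 * (c y ^ 2 * v x y ^ 2) + N * U x y - N * K
    + (C2 + 1) * q ^ 2 * (y ^ 2 - 9 * r ^ 2 / 4) / 2
  have hvc : ContinuousOn (fun z : ℝ × ℝ => v z.1 z.2) (Icc l X₂ ×ˢ Icc (r / 2) (3 * r / 2)) :=
    (ContDiffOn.continuousOn hv).mono hsub
  have hUc : ContinuousOn (fun z : ℝ × ℝ => U z.1 z.2) (Icc l X₂ ×ˢ Icc (r / 2) (3 * r / 2)) :=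
    (ContDiffOn.continuousOn hU).mono hsub
  have hcc : Continuous c := by simp only [c]; fun_prop
  have hbd : ∀ x y, (x, y) ∈ Icc l X₂ ×ˢ Icc (r / 2) (3 * r / 2) →
      N * U x y - N * K + (C2 + 1) * q ^ 2 * (y ^ 2 - 9 * r ^ 2 / 4) / 2 ≤ 0 := by
    intro x y hz
    have h1 := mul_le_mul_of_nonneg_left ((le_abs_self _).trans (H x y hz).2.2.2.2) hN0
    have h2 : y ^ 2 - 9 * r ^ 2 / 4 ≤ 0 := by nlinarith [hz.2.1, hz.2.2]
    have h3 : 0 ≤ (C2 + 1) * q ^ 2 := by positivity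
    nlinarith [mul_nonneg h3 (neg_nonneg.2 h2)]
  have key := max_principle (l := l) (X₂ := X₂) (y₁ := r / 2) (y₂ := 3 * r / 2) Z ?_ ?_ ?_ ?_ ?_
    x hx r ⟨by linarith, by linarith⟩
  · have hz : (x, r) ∈ Icc l X₂ ×ˢ Icc (r / 2) (3 * r / 2) := ⟨hx, ⟨by linarith, by linarith⟩⟩
    have hcr : c r = 1 / 4 := by
      simp only [c]
      linear_combination (1 / 4) * hrq2
    simp only [Z, hcr] at key
    have h1 := (abs_le.1 (H x r hz).2.2.2.2).1
    have h2 : (C2 + 1) * q ^ 2 * (r ^ 2 - 9 * r ^ 2 / 4) / 2 = - (C2 + 1) * (5 / 8) := by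
      linear_combination (- (C2 + 1) * (5 / 8)) * hrq2
    rw [h2] at key
    nlinarith [mul_le_mul_of_nonneg_left h1 hN0]
  · refine ContinuousOn.add (ContinuousOn.sub (ContinuousOn.add (ContinuousOn.mul ?_
      (ContinuousOn.mul ?_ (hvc.pow 2))) (continuousOn_const.mul hUc)) continuousOn_const) ?_
    all_goals exact Continuous.continuousOn (by fun_prop)
  · intro y hy
    rcases le_or_gt l X₂ with h | h
    · have := hbd l y ⟨⟨le_rfl, h⟩, hy⟩
      simp only [Z, sub_self]; linarith
    · exact absurd (hx.1.trans hx.2) (not_le.2 h)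
  · intro x' hx'
    have := hbd x' (r / 2) ⟨hx', ⟨le_rfl, by linarith⟩⟩
    simp only [Z, c, sub_self]; linarith
  · intro x' hx'
    have := hbd x' (3 * r / 2) ⟨hx', ⟨by linarith, le_rfl⟩⟩
    simp only [Z, c, sub_self]; linarith
  · intro x hx y hy _
    have hz : (x, y) ∈ Icc l X₂ ×ˢ Icc (r / 2) (3 * r / 2) := ⟨⟨hx.1.le, hx.2⟩, ⟨hy.1.le, hy.2.le⟩⟩
    obtain ⟨hb0, hb1, hT, hLU, hUK⟩ := H x y hz
    have hzΩ := hsub hz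
    refine ⟨b x y, 2 * (x - l) * (c y ^ 2 * v x y ^ 2) + (x - l) ^ 2 * (c y ^ 2 * (2 * v x y * Dx v x y))
        + N * Dx U x y,
      (x - l) ^ 2 * ((2 * c' y ^ 2 + 2 * c y * (-2 * q ^ 2)) * v x y ^ 2 + 8 * c y * c' y * v x y * Dy v x y
        + 2 * c y ^ 2 * Dy v x y ^ 2 + 2 * c y ^ 2 * v x y * Dy (Dy v) x y)
        + N * Dy (Dy U) x y + (C2 + 1) * q ^ 2,
      fun y => (x - l) ^ 2 * (2 * c y * c' y * v x y ^ 2 + c y ^ 2 * (2 * v x y * Dy v x y))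
        + N * Dy U x y + (C2 + 1) * q ^ 2 * y, hb0, ?_, ?_, ?_, ?_⟩
    · have := ((((((hasDerivAt_id x).sub_const l).pow 2).mul (((hv.hx hΩ hzΩ).pow 2).const_mul (c y ^ 2))).add
        ((hU.hx hΩ hzΩ).const_mul N)).sub_const (N * K)).add_const
          ((C2 + 1) * q ^ 2 * (y ^ 2 - 9 * r ^ 2 / 4) / 2)
      refine HasDerivAt.congr_deriv this ?_
      simp only [Pi.mul_apply, Pi.pow_apply, Pi.add_apply, id_eq, Nat.cast_ofNat, Nat.reduceSub, pow_one]; ring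
    · filter_upwards [evy hΩ hzΩ] with y' hy'
      have := ((((((hcd y').pow 2).mul ((hv.hy hΩ hy').pow 2)).const_mul ((x - l) ^ 2)).add
        ((hU.hy hΩ hy').const_mul N)).sub_const (N * K)).add
          (((((hasDerivAt_id y').pow 2).sub_const (9 * r ^ 2 / 4)).const_mul ((C2 + 1) * q ^ 2)).div_const 2)
      refine HasDerivAt.congr_deriv this ?_
      simp only [Pi.mul_apply, Pi.pow_apply, Pi.add_apply, id_eq, Nat.cast_ofNat, Nat.reduceSub, pow_one]; ring
    · have hvy := (hv.dy hΩ).hy hΩ hzΩ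
      have hv1 := hv.hy hΩ hzΩ
      have hUy := (hU.dy hΩ).hy hΩ hzΩ
      have := (((((((hcd y).const_mul 2).mul (hcd' y)).mul (hv1.pow 2)).add
        (((hcd y).pow 2).mul ((hv1.const_mul 2).mul hvy))).const_mul ((x - l) ^ 2)).add
        (hUy.const_mul N)).add ((hasDerivAt_id y).const_mul ((C2 + 1) * q ^ 2))
      refine HasDerivAt.congr_deriv this ?_
      simp only [Pi.mul_apply, Pi.pow_apply, Pi.add_apply, id_eq, Nat.cast_ofNat, Nat.reduceSub, pow_one]; ring
    · have hc0 : 0 ≤ c y := by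
        simp only [c]
        exact mul_nonneg (mul_nonneg (by linarith [hy.1]) (by linarith [hy.2])) (sq_nonneg q)
      have hc1 : c y ≤ 1 := by
        have : (y - r / 2) * (3 * r / 2 - y) ≤ r ^ 2 := by nlinarith [sq_nonneg (y - r), sq_nonneg r]
        have := mul_le_mul_of_nonneg_right this (sq_nonneg q)
        simp only [c]; linarith
      have hc' : |c' y| ≤ q := by
        have h1 : |2 * r - 2 * y| ≤ r := by rw [abs_le]; constructor <;> linarith [hy.1, hy.2]
        simp only [c']
        rw [abs_mul, abs_of_nonneg (sq_nonneg q)]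
        have := mul_le_mul_of_nonneg_right h1 (sq_nonneg q)
        nlinarith
      have ha := bern_alg (L := x - l) hK (by linarith [hx.1]) (by linarith [hx.2] : x - l ≤ R) hq.le hc0 hc1 hc' hb1 hT
      rw [← hC3] at ha
      have hNU := mul_le_mul_of_nonneg_left hLU hN0
      have hNκ : N * κ = C3 := by rw [hN]; field_simp
      have hq2 : 0 < q ^ 2 := by positivity
      have e1 : N * (-κ * q ^ 2 * v x y ^ 2 + K * q ^ 2) = - C3 * q ^ 2 * v x y ^ 2 + N * K * q ^ 2 := by
        rw [← hNκ]; ring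
      rw [e1] at hNU
      have e2 : (C2 + 1) * q ^ 2 = R ^ 2 * K * q ^ 2 + N * K * q ^ 2 + q ^ 2 := by rw [hC2]; ring
      rw [e2]
      linarith


def Reg (l X d : ℝ) : Set (ℝ × ℝ) := Ioo l X ×ˢ Ioo 0 d

structure Base (w : ℝ → ℝ → ℝ) (P : ℝ → ℝ) (m M X l d : ℝ) : Prop where
  hd : 0 < d
  hd1 : d ≤ 1
  hm : 0 < m
  hM : 0 < M
  hP : ContDiff ℝ ∞ P
  hPn : ∀ x, P x ≤ 0
  hw : Sm (Reg l X d) w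
  hwm : ∀ x y, (x, y) ∈ Reg l X d → m * y ≤ w x y
  hwM : ∀ x y, (x, y) ∈ Reg l X d → w x y ≤ M * y
  heq : EqR (Reg l X d) (Dy (Dy w)) (fun x y => bb w x y * (Dx w x y + 2 * P x))

lemma Reg_open (l X d : ℝ) : IsOpen (Reg l X d) := isOpen_Ioo.prod isOpen_Ioo

lemma Reg_mono {l l' X X' d d' : ℝ} (hl : l ≤ l') (hX : X' ≤ X) (hd : d' ≤ d) :
    Reg l' X' d' ⊆ Reg l X d :=
  fun _ hz => ⟨⟨hl.trans_lt hz.1.1, hz.1.2.trans_le hX⟩, ⟨hz.2.1, hz.2.2.trans_le hd⟩⟩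

section rounds
variable {w : ℝ → ℝ → ℝ} {P : ℝ → ℝ} {m M X l d : ℝ}

lemma Base.mono (H : Base w P m M X l d) {l' d' : ℝ} (hl : l ≤ l') (hd0 : 0 < d') (hd : d' ≤ d) :
    Base w P m M X l' d' :=
  have hs := Reg_mono hl le_rfl hd (X := X)
  ⟨hd0, hd.trans H.hd1, H.hm, H.hM, H.hP, H.hPn, H.hw.mono hs, fun x y h => H.hwm x y (hs h),
    fun x y h => H.hwM x y (hs h), fun x y h => H.heq x y (hs h)⟩

lemma Base.hp (H : Base w P m M X l d) : ∀ x y, (x, y) ∈ Reg l X d → 0 < y ∧ y < 1 :=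
  fun _ _ h => ⟨h.2.1, h.2.2.trans_le H.hd1⟩

lemma Base.hl (_H : Base w P m M X l d) : ∀ x y, (x, y) ∈ Reg l X d → x ∈ Icc l X :=
  fun _ _ h => ⟨h.1.1.le, h.1.2.le⟩

lemma Base.fyy (H : Base w P m M X l d) (n : ℕ) : EqR (Reg l X d) (Dy (Dy (Dx^[n + 1] w)))
    (fun x y => bb w x y * Dx (Dx^[n + 1] w) x y + EE w P (n + 1) x y * Dx^[n + 1] w x y
      + SS w P n x y) := by
  have hΩ := Reg_open l X d
  intro x y h
  have h1 := eq_n hΩ H.hp H.hm H.hw H.hwm H.hP n x y h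
  have h2 := Dxn_congr hΩ H.heq (n + 1) x y h
  have h3 := (H.hw.dy hΩ).commn hΩ (n + 1) x y h
  have h4 := Dy_congr hΩ (H.hw.commn hΩ (n + 1)) x y h
  rw [← h4, ← h3, h2, h1]
  beta_reduce
  rw [← Function.iterate_succ_apply' (f := Dx) (n := n + 1)]

lemma Bd_diff {Ω : Set (ℝ × ℝ)} (hΩ : IsOpen Ω) {u : ℝ → ℝ → ℝ} (hu : Sm Ω u) {x h y C r : ℝ}
    (hh : 0 ≤ h) (hs : ∀ t ∈ Icc x (x + h), (t, y) ∈ Ω)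
    (hC : ∀ x y, (x, y) ∈ Ω → |Dx u x y| ≤ C * y ^ r) :
    |u (x + h) y - u x y| ≤ h * (C * y ^ r) := by
  have := (convex_Icc x (x + h)).norm_image_sub_le_of_norm_hasDerivWithin_le
    (f := fun x' => u x' y) (f' := fun x' => Dx u x' y) (C := C * y ^ r)
    (fun t ht => (hu.hx hΩ (hs t ht)).hasDerivWithinAt)
    (fun t ht => hC t y (hs t ht)) (left_mem_Icc.2 (by linarith)) (right_mem_Icc.2 (by linarith))
  simp only [Real.norm_eq_abs, add_sub_cancel_left, abs_of_nonneg hh] at this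
  linarith

/-- the non-sign-definite part of `EE` -/
lemma EE_split (n : ℕ) (x y : ℝ) : EE w P n x y
    = -(c3 w x y * P x) + -(((n : ℝ) + 1) / 2) * (c3 w x y * Dx w x y) := by
  simp only [EE]; ring

lemma bb_nonneg (x y : ℝ) : 0 ≤ bb w x y := inv_nonneg.2 (Real.sqrt_nonneg _)
lemma c3_nonneg (x y : ℝ) : 0 ≤ c3 w x y :=
  mul_nonneg (bb_nonneg _ _) (mul_nonneg (bb_nonneg _ _) (bb_nonneg _ _))

lemma rpow_small {s : ℝ} (hs : 0 < s) (C : ℝ) (hC : 0 ≤ C) {σ : ℝ} (hσ : 0 < σ) :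
    ∃ ρ > 0, ∀ y, 0 < y → y ≤ ρ → C * y ^ s ≤ σ := by
  refine ⟨(σ / (C + 1)) ^ (s⁻¹), by positivity, fun y hy hy' => ?_⟩
  have h1 : y ^ s ≤ σ / (C + 1) := by
    have := Real.rpow_le_rpow hy.le hy' hs.le
    rwa [← Real.rpow_mul (by positivity), inv_mul_cancel₀ hs.ne', Real.rpow_one] at this
  calc C * y ^ s ≤ (C + 1) * (σ / (C + 1)) := by
        apply mul_le_mul (by linarith) h1 (by positivity) (by positivity)
    _ = σ := by field_simp

lemma round2 (H : Base w P m M X l d) {n : ℕ} (hcl : Cl (Reg l X d) (n + 1) 1 w)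
    (hf : Bd (Reg l X d) (1 / 2) (Dx^[n + 2] w)) {l' d' : ℝ} (hl' : l < l') (hd'0 : 0 < d')
    (hd' : d' < d) : Bd (Reg l' X d') 1 (Dx^[n + 2] w) := by
  have hΩ := Reg_open l X d
  have hp := H.hp
  set f := Dx^[n + 2] w with hfdef
  have hfs : Sm (Reg l X d) f := H.hw.dxn hΩ _
  have hbb := bb_bd hp H.hm H.hwm
  have hc3 := (c3_cl hΩ hp H.hm H.hwm hcl).bd
  have hwx : Bd (Reg l X d) 1 (Dx w) := hcl.dx.bd
  have hS := (SS_cl hΩ hp H.hm H.hwm H.hl H.hP n 0 (by simpa using hcl)).bd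
  let E : ℝ → ℝ → ℝ := fun x y => -((((n + 2 : ℕ) : ℝ) + 1) / 2) * (c3 w x y * Dx w x y * f x y)
    + SS w P (n + 1) x y
  have hE : Bd (Reg l X d) (-1 / 2) E :=
    ((((hc3.mul hp hwx rfl).mul hp hf rfl).weak hp (by norm_num)).cmul _).add hS
  have hbf : Bd (Reg l X d) (-1 / 2) (fun x y => bb w x y * f x y) :=
    (hbb.mul hp hf rfl).weak hp (by norm_num)
  obtain ⟨K1, hK1, hE⟩ := hE
  obtain ⟨K2, hK2, hbf⟩ := hbf
  obtain ⟨Cf, hCf, hf⟩ := hf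
  set l1 := (l + l') / 2 with hl1
  set R := |X - l1| with hR
  have hR0 : 0 ≤ R := abs_nonneg _
  set A := 2 * (K2 + R * K1) + 1 + R * (Cf * d' ^ (1 / 2 : ℝ)) / d' with hA
  have hA0 : 0 ≤ A := by positivity
  refine ⟨2 * A / (l' - l1), div_nonneg (by positivity) (by linarith), fun x y hz => ?_⟩
  have hsub : Icc l1 x ×ˢ Ioc 0 d' ⊆ Reg l X d := by
    rintro ⟨a, b⟩ ⟨⟨h1, h2⟩, h3, h4⟩
    exact ⟨⟨by simp only at *; linarith, by have := hz.1.2; simp only at *; linarith⟩,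
      ⟨h3, lt_of_le_of_lt h4 hd'⟩⟩
  have hxR : x - l1 ≤ R := le_trans (by have := hz.1.2; simp only at this; linarith) (le_abs_self _)
  have hxl : l' < x := hz.1.1
  have key := barrier hΩ (A := A) hsub hfs (bb w) (fun x y => -(c3 w x y * P x)) E
    (fun y => 2 * y - y ^ (3 / 2 : ℝ)) (fun y => 2 - 3 / 2 * y ^ (1 / 2 : ℝ))
    (fun y => - (3 / 4 * y ^ (-1 / 2 : ℝ))) hA0 ?_ ?_ ?_ ?_ ?_ ?_ ?_ ?_ ?_ x ⟨by linarith, le_rfl⟩ y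
    ⟨hz.2.1, hz.2.2.le⟩
  · have hy : 0 < y := hz.2.1
    have h3 : 0 ≤ y ^ (3 / 2 : ℝ) := by positivity
    have h4 : (l' - l1) * |f x y| ≤ A * (2 * y) :=
      (mul_le_mul_of_nonneg_right (by linarith) (abs_nonneg _)).trans
        (key.trans (mul_le_mul_of_nonneg_left (by linarith) hA0))
    rw [Real.rpow_one, div_mul_eq_mul_div, le_div_iff₀ (by linarith)]
    linarith
  · intro y hy
    have h1 : y ^ (3 / 2 : ℝ) ≤ y ^ (1 : ℝ) :=
      Real.rpow_le_rpow_of_exponent_ge hy.1 (by linarith [hy.2, H.hd1]) (by norm_num)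
    rw [Real.rpow_one] at h1
    have := hy.1
    beta_reduce; linarith
  · intro y hy
    have := ((hasDerivAt_id y).const_mul 2).sub (Real.hasDerivAt_rpow_const (x := y) (p := 3 / 2) (Or.inl hy.1.ne'))
    refine this.congr_deriv ?_
    norm_num
  · intro y hy
    have := ((Real.hasDerivAt_rpow_const (x := y) (p := 1 / 2) (Or.inl hy.1.ne')).const_mul (3 / 2)).const_sub 2
    refine this.congr_deriv ?_
    norm_num; ring
  · exact fun x _ y _ => bb_nonneg x y
  · intro x _ y _
    have := mul_nonneg (c3_nonneg (w := w) x y) (neg_nonneg.2 (H.hPn x))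
    beta_reduce; linarith
  · intro x hx y hy
    have h := H.fyy (n + 1) x y (hsub ⟨hx, hy⟩)
    change Dy (Dy f) x y = bb w x y * Dx f x y + EE w P (n + 2) x y * f x y
      + SS w P (n + 1) x y at h
    rw [h, EE_split]
    simp only [E]
    ring
  · intro x' hx y hy
    have hm := hsub (show (x', y) ∈ _ from ⟨hx, hy⟩)
    have h1 := hE x' y hm
    have h2 := hbf x' y hm
    rw [abs_mul, abs_of_nonneg (bb_nonneg x' y)] at h2
    have h3 : 0 < y ^ (-1 / 2 : ℝ) := Real.rpow_pos_of_pos hy.1 _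
    have h4 : (x - l1) * |E x' y| ≤ R * (K1 * y ^ (-1 / 2 : ℝ)) :=
      mul_le_mul hxR h1 (abs_nonneg _) hR0
    have h5 : 0 ≤ R * (Cf * d' ^ (1 / 2 : ℝ)) / d' := by positivity
    have h6 : 0 ≤ K2 + R * K1 := by positivity
    have h7 : (K2 + R * K1) * y ^ (-1 / 2 : ℝ) < A * (3 / 4) * y ^ (-1 / 2 : ℝ) :=
      mul_lt_mul_of_pos_right (by linarith) h3
    beta_reduce
    linarith
  · intro x' hx
    have hm := hsub (show (x', d') ∈ _ from ⟨hx, ⟨hd'0, le_rfl⟩⟩)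
    have h1 := mul_le_mul hxR (hf x' d' hm) (abs_nonneg _) hR0
    have h2 : d' ^ (3 / 2 : ℝ) ≤ d' ^ (1 : ℝ) :=
      Real.rpow_le_rpow_of_exponent_ge hd'0 (by linarith [H.hd1]) (by norm_num)
    rw [Real.rpow_one] at h2
    refine h1.trans ?_
    calc R * (Cf * d' ^ (1 / 2 : ℝ)) = R * (Cf * d' ^ (1 / 2 : ℝ)) / d' * d' := by field_simp
      _ ≤ A * (2 * d' - d' ^ (3 / 2 : ℝ)) := by
        apply mul_le_mul _ (by linarith) hd'0.le hA0
        have : 0 ≤ K2 + R * K1 := by positivity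
        linarith
  · intro σ hσ
    obtain ⟨ρ, hρ, h⟩ := rpow_small (s := 1 / 2) (by norm_num) (R * Cf) (by positivity) hσ
    refine ⟨ρ, hρ, fun x' hx y hy hy' => ?_⟩
    have hm := hsub (show (x', y) ∈ _ from ⟨hx, hy⟩)
    refine (mul_le_mul hxR (hf x' y hm) (abs_nonneg _) hR0).trans ?_
    rw [← mul_assoc]
    exact h y hy.1 hy'

end rounds


section rounds
variable {w : ℝ → ℝ → ℝ} {P : ℝ → ℝ} {m M X l d : ℝ}

lemma round1_bounds (H : Base w P m M X l d) {n : ℕ} (hcl : Cl (Reg l X d) (n + 1) 1 w)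
    (hf : Bd (Reg l X d) (-1 / 2) (Dx^[n + 2] w)) :
    Bd (Reg l X d) (-2) (Dx (EE w P (n + 1))) ∧ Bd (Reg l X d) (-1) (Dx (SS w P n)) := by
  have hΩ := Reg_open l X d
  have hp := H.hp
  have hc3 := c3_cl hΩ hp H.hm H.hwm hcl
  have hw2 : Bd (Reg l X d) (-1 / 2) (Dx (Dx w)) := by
    rcases n with _ | n
    · exact hf
    · exact hcl.dx.dx.bd.weak hp (by norm_num)
  have hE : Bd (Reg l X d) (-2) (Dx (EE w P (n + 1))) := by
    have hPs : Sm (Reg l X d) (fun x _ => P x) := Sm_fx H.hP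
    have hwxs : Sm (Reg l X d) (fun x y => (((n + 1 : ℕ) : ℝ) + 1) / 2 * Dx w x y) :=
      Sm.mul contDiffOn_const (H.hw.dx hΩ)
    have e : EqR (Reg l X d) (Dx (EE w P (n + 1))) (fun x y =>
        -1 * (Dx (c3 w) x y * (P x + (((n + 1 : ℕ) : ℝ) + 1) / 2 * Dx w x y)
          + c3 w x y * (deriv P x + (((n + 1 : ℕ) : ℝ) + 1) / 2 * Dx (Dx w) x y))) := by
      intro x y h
      have h1 := (hc3.sm.hx hΩ h).mul (((H.hP.differentiable (by simp) x).hasDerivAt).add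
        (((H.hw.dx hΩ).hx hΩ h).const_mul ((((n + 1 : ℕ) : ℝ) + 1) / 2)))
      exact (h1.const_mul (-1)).deriv
    have hPb : Bd (Reg l X d) 0 (fun x _ => P x) := (Cl_fx (n := 0) H.hl H.hP).bd
    have hPb' : Bd (Reg l X d) 0 (fun x _ => deriv P x) := (Cl_fx (n := 0) H.hl (dP_smooth H.hP)).bd
    refine Bd.congr (Bd.cmul (Bd.add (Bd.weak hp (Bd.mul hp hc3.dx.bd (hPb.add
      ((hcl.dx.bd.weak hp (by norm_num)).cmul _)) rfl) (by norm_num)) ?_) _) e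
    exact Bd.mul hp hc3.bd ((hPb'.weak hp (by norm_num)).add (hw2.cmul _)) (by norm_num)
  refine ⟨hE, ?_⟩
  have hS := (SS_cl hΩ hp H.hm H.hwm H.hl H.hP n 0 (by simpa using hcl)).bd
  have hg : Bd (Reg l X d) 1 (Dx^[n + 1] w) := (Cl.dxn (n := 0) (n + 1) (by simpa using hcl)).bd
  refine ((hS.weak hp (by norm_num : (-1 : ℝ) ≤ _)).add ((hE.mul hp hg (by norm_num : _ = (-1 : ℝ))).cmul (-1))).congr ?_
  intro x y _
  simp only [SS]
  ring

lemma round1_G (H : Base w P m M X l d) {n : ℕ} (hcl : Cl (Reg l X d) (n + 1) 1 w)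
    (hf : Bd (Reg l X d) (-1 / 2) (Dx^[n + 2] w)) :
    ∃ K, 0 ≤ K ∧ ∀ h, 0 ≤ h → ∀ x y, (x, y) ∈ Reg l (X - h) d →
      |Dx^[n + 1] w (x + h) y - Dx^[n + 1] w x y| ≤ h * (K * y ^ (-1 / 2 : ℝ)) ∧
      bb w (x + h) y * |Dx^[n + 1] w (x + h) y - Dx^[n + 1] w x y| ≤ h * (K * y ^ (-1 : ℝ)) ∧
      |bb w (x + h) y * Dx^[n + 2] w (x + h) y + EE w P (n + 1) (x + h) y * Dx^[n + 1] w (x + h) y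
        + SS w P n (x + h) y
        - (bb w x y * Dx^[n + 2] w x y + EE w P (n + 1) x y * Dx^[n + 1] w x y
        + SS w P n x y) - bb w (x + h) y * (Dx^[n + 2] w (x + h) y - Dx^[n + 2] w x y)
        + c3 w (x + h) y * P (x + h) * (Dx^[n + 1] w (x + h) y - Dx^[n + 1] w x y)|
        ≤ h * (K * y ^ (-1 : ℝ)) := by
  have hΩ := Reg_open l X d
  have hp := H.hp
  obtain ⟨⟨K1, hK1, hE⟩, ⟨K2, hK2, hS⟩⟩ := round1_bounds H hcl hf
  have hbs := bb_sm hp H.hm H.hw H.hwm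
  have hEs := EE_sm hΩ hp H.hm H.hw H.hwm H.hP (n + 1)
  have hSs := SS_sm hΩ hp H.hm H.hw H.hwm H.hP n
  have hgs : Sm (Reg l X d) (Dx^[n + 1] w) := H.hw.dxn hΩ _
  have hbx : Bd (Reg l X d) (-1 / 2) (Dx (bb w)) := (bb_cl hΩ hp H.hm H.hwm hcl).dx.bd
  have hcw : Bd (Reg l X d) (-1 / 2) (fun x y => c3 w x y * Dx w x y) :=
    (c3_cl hΩ hp H.hm H.hwm hcl).bd.mul hp hcl.dx.bd (by norm_num)
  have hg : Bd (Reg l X d) 1 (Dx^[n + 1] w) := (Cl.dxn (n := 0) (n + 1) (by simpa using hcl)).bd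
  obtain ⟨K3, hK3, hbx⟩ := hbx
  obtain ⟨K4, hK4, hcw⟩ := hcw
  obtain ⟨K5, hK5, hf⟩ := hf
  obtain ⟨K6, hK6, hg⟩ := hg
  obtain ⟨K7, hK7, hbb⟩ := bb_bd hp H.hm H.hwm
  set N : ℝ := (((n + 1 : ℕ) : ℝ) + 1) / 2 with hN
  have hN0 : 0 ≤ N := by positivity
  refine ⟨K5 + K7 * K5 + (K3 * K5 + N * K4 * K5 + K1 * K6 + K2), by positivity, ?_⟩
  intro h hh x y hz
  have hy : 0 < y := hz.2.1
  have hs : ∀ t ∈ Icc x (x + h), (t, y) ∈ Reg l X d := fun t ht =>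
    ⟨⟨hz.1.1.trans_le ht.1, by have := hz.1.2; have := ht.2; simp only at *; linarith⟩, hz.2⟩
  have hx0 := hs x (left_mem_Icc.2 (by linarith))
  have hx1 := hs (x + h) (right_mem_Icc.2 (by linarith))
  have dG := Bd_diff hΩ hgs hh hs (C := K5) (r := -1 / 2) (by
    intro x y hz
    have := hf x y hz
    rwa [Function.iterate_succ_apply'] at this)
  have db := Bd_diff hΩ hbs hh hs hbx
  have dE := Bd_diff hΩ hEs hh hs hE
  have dS := Bd_diff hΩ hSs hh hs hS
  have f0 := hf x y hx0
  have g0 := hg x y hx0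
  have c1 := hcw (x + h) y hx1
  have b1 := hbb (x + h) y hx1
  beta_reduce at c1
  rw [EE_split (w := w) (P := P) (n + 1) (x + h) y] at dE ⊢
  rw [abs_of_nonneg (bb_nonneg _ _)] at b1
  rw [← hN] at *
  generalize Dx^[n + 1] w (x + h) y = g' at *
  generalize Dx^[n + 1] w x y = g at *
  generalize Dx^[n + 2] w (x + h) y = f' at *
  generalize Dx^[n + 2] w x y = f at *
  have hb0 := bb_nonneg (w := w) (x + h) y
  generalize bb w (x + h) y = b' at *
  generalize bb w x y = b at *
  generalize c3 w (x + h) y * Dx w (x + h) y = cw at *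
  generalize c3 w (x + h) y * P (x + h) = cP at *
  generalize EE w P (n + 1) x y = e at *
  generalize SS w P n (x + h) y = S' at *
  generalize SS w P n x y = S at *
  have e1 : y ^ (-1 / 2 : ℝ) * y ^ (-1 / 2 : ℝ) = y ^ (-1 : ℝ) := by
    rw [← Real.rpow_add hy]; norm_num
  have e2 : y ^ (-2 : ℝ) * y ^ (1 : ℝ) = y ^ (-1 : ℝ) := by
    rw [← Real.rpow_add hy]; norm_num
  have q1 : 0 ≤ y ^ (-1 / 2 : ℝ) := by positivity
  have q2 : 0 ≤ y ^ (-1 : ℝ) := by positivity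
  have q3 : 0 ≤ y ^ (-2 : ℝ) := by positivity
  have t1 : |(b' - b) * f| ≤ h * (K3 * K5 * y ^ (-1 : ℝ)) := by
    rw [abs_mul]
    refine (mul_le_mul db f0 (abs_nonneg _) (by positivity)).trans (le_of_eq ?_)
    rw [← e1]; ring
  have t2 : |N * (cw * (g' - g))| ≤ h * (N * K4 * K5 * y ^ (-1 : ℝ)) := by
    rw [abs_mul, abs_mul, abs_of_nonneg hN0]
    refine (mul_le_mul_of_nonneg_left (mul_le_mul c1 dG (abs_nonneg _) (by positivity)) hN0).trans (le_of_eq ?_)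
    rw [← e1]; ring
  have t3 : |(-cP + -N * cw - e) * g| ≤ h * (K1 * K6 * y ^ (-1 : ℝ)) := by
    rw [abs_mul]
    refine (mul_le_mul dE g0 (abs_nonneg _) (by positivity)).trans (le_of_eq ?_)
    rw [← e2]; ring
  have t4 : b' * |g' - g| ≤ h * (K7 * K5 * y ^ (-1 : ℝ)) := by
    refine (mul_le_mul b1 dG (abs_nonneg _) (by positivity)).trans (le_of_eq ?_)
    rw [← e1]; ring
  have z1 : 0 ≤ h * (K7 * K5 * y ^ (-1 : ℝ)) := by positivity
  have z2 : 0 ≤ h * (K5 * y ^ (-1 : ℝ)) := by positivity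
  have z3 : 0 ≤ h * ((K3 * K5 + N * K4 * K5 + K1 * K6 + K2) * y ^ (-1 : ℝ)) := by positivity
  refine ⟨dG.trans ?_, t4.trans ?_, ?_⟩
  · have : 0 ≤ h * ((K7 * K5 + (K3 * K5 + N * K4 * K5 + K1 * K6 + K2)) * y ^ (-1 / 2 : ℝ)) := by positivity
    linarith
  · linarith
  · have : b' * f' + (-cP + -N * cw) * g' + S' - (b * f + e * g + S) - b' * (f' - f) + cP * (g' - g)
      = (b' - b) * f - N * (cw * (g' - g)) + (-cP + -N * cw - e) * g + (S' - S) := by ring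
    rw [this]
    have a1 := abs_add_le ((b' - b) * f - N * (cw * (g' - g)) + (-cP + -N * cw - e) * g) (S' - S)
    have a2 := abs_add_le ((b' - b) * f - N * (cw * (g' - g))) ((-cP + -N * cw - e) * g)
    have a3 := abs_sub ((b' - b) * f) (N * (cw * (g' - g)))
    linarith

end rounds


section rounds
variable {w : ℝ → ℝ → ℝ} {P : ℝ → ℝ} {m M X l d : ℝ}

lemma diff_derivs {g : ℝ → ℝ → ℝ} {h : ℝ} (hh : 0 ≤ h) (hg : Sm (Reg l X d) g) :
    Sm (Reg l (X - h) d) (fun x y => g (x + h) y - g x y) ∧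
    (∀ x y, (x, y) ∈ Reg l (X - h) d → Dx (fun x y => g (x + h) y - g x y) x y
      = Dx g (x + h) y - Dx g x y) ∧
    (∀ x y, (x, y) ∈ Reg l (X - h) d → Dy (fun x y => g (x + h) y - g x y) x y
      = Dy g (x + h) y - Dy g x y) := by
  have hΩ := Reg_open l X d
  have hs0 : Reg l (X - h) d ⊆ Reg l X d := Reg_mono le_rfl (by linarith) le_rfl
  have hs1 : ∀ x y, (x, y) ∈ Reg l (X - h) d → (x + h, y) ∈ Reg l X d := fun x y hz =>
    ⟨⟨by have := hz.1.1; simp only at *; linarith, by have := hz.1.2; simp only at *; linarith⟩, hz.2⟩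
  refine ⟨?_, fun x y hz => ?_, fun x y hz => ?_⟩
  · refine ContDiffOn.sub ?_ (hg.mono hs0)
    have hc : ContDiff ℝ ∞ (fun z : ℝ × ℝ => (z.1 + h, z.2)) := by fun_prop
    exact ContDiffOn.comp (g := fun z : ℝ × ℝ => g z.1 z.2) hg hc.contDiffOn
      (fun z hz => hs1 z.1 z.2 hz)
  · have h1 := (hg.hx hΩ (hs1 x y hz)).comp_add_const x h
    exact (h1.sub (hg.hx hΩ (hs0 hz))).deriv
  · exact ((hg.hy hΩ (hs1 x y hz)).sub (hg.hy hΩ (hs0 hz))).deriv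

lemma round1 (H : Base w P m M X l d) {n : ℕ} (hcl : Cl (Reg l X d) (n + 1) 1 w)
    (hf : Bd (Reg l X d) (-1 / 2) (Dx^[n + 2] w)) {l' d' : ℝ} (hl' : l < l') (hd'0 : 0 < d')
    (hd' : d' < d) : Bd (Reg l' X d') (1 / 2) (Dx^[n + 2] w) := by
  have hΩ := Reg_open l X d
  have hp := H.hp
  obtain ⟨K, hK, hG⟩ := round1_G H hcl hf
  have hgs : Sm (Reg l X d) (Dx^[n + 1] w) := H.hw.dxn hΩ _
  obtain ⟨Cg, hCg, hgb⟩ : Bd (Reg l X d) 1 (Dx^[n + 1] w) :=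
    (Cl.dxn (n := 0) (n + 1) (by simpa using hcl)).bd
  have hfyy := H.fyy n
  set g := Dx^[n + 1] w with hg
  have hff : Dx^[n + 2] w = Dx g := by rw [Function.iterate_succ_apply']
  rw [hff] at hG ⊢
  set l1 := (l + l') / 2 with hl1
  set R := |X - l1| with hR
  have hR0 : 0 ≤ R := abs_nonneg _
  set A := 4 * (K + R * K) + 1 + R * (K * d' ^ (-1 / 2 : ℝ)) / d' ^ (1 / 2 : ℝ) with hA
  have hA0 : 0 ≤ A := by positivity
  have hq : 0 < d' ^ (1 / 2 : ℝ) := by positivity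
  refine ⟨A / (l' - l1), div_nonneg (by positivity) (by linarith), fun x y hz => ?_⟩
  have hy : 0 < y := hz.2.1
  have hxl : l' < x := hz.1.1
  have hxX : x < X := hz.1.2
  have hzΩ : (x, y) ∈ Reg l X d := Reg_mono hl'.le le_rfl hd'.le hz
  have hxR : x - l1 ≤ R := le_trans (by linarith) (le_abs_self _)
  have main : ∀ h, 0 < h → h < X - x →
      (x - l1) * |g (x + h) y - g x y| ≤ h * A * y ^ (1 / 2 : ℝ) := by
    intro h hh hhX
    have hsub : Icc l1 x ×ˢ Ioc 0 d' ⊆ Reg l (X - h) d := by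
      rintro ⟨a, b⟩ ⟨⟨h1, h2⟩, h3, h4⟩
      exact ⟨⟨by simp only at *; linarith, by simp only at *; linarith⟩,
        ⟨h3, lt_of_le_of_lt h4 hd'⟩⟩
    have hs0 : Reg l (X - h) d ⊆ Reg l X d := Reg_mono le_rfl (by linarith) le_rfl
    have hs1 : ∀ x y, (x, y) ∈ Reg l (X - h) d → (x + h, y) ∈ Reg l X d := fun x y hz =>
      ⟨⟨by have := hz.1.1; simp only at *; linarith, by have := hz.1.2; simp only at *; linarith⟩, hz.2⟩
    have hΩh := Reg_open l (X - h) d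
    obtain ⟨sG, xG, yG⟩ := diff_derivs hh.le hgs
    obtain ⟨-, -, yyG⟩ := diff_derivs hh.le (hgs.dy hΩ)
    have key := barrier hΩh (A := h * A) hsub sG (fun x y => bb w (x + h) y)
      (fun x y => -(c3 w (x + h) y * P (x + h)))
      (fun x y => bb w (x + h) y * Dx g (x + h) y + EE w P (n + 1) (x + h) y * g (x + h) y
        + SS w P n (x + h) y
        - (bb w x y * Dx g x y + EE w P (n + 1) x y * g x y
        + SS w P n x y) - bb w (x + h) y * (Dx g (x + h) y - Dx g x y)
        + c3 w (x + h) y * P (x + h) * (g (x + h) y - g x y))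
      (fun y => y ^ (1 / 2 : ℝ)) (fun y => 1 / 2 * y ^ (-1 / 2 : ℝ))
      (fun y => - (1 / 4 * y ^ (-3 / 2 : ℝ))) (by positivity) ?_ ?_ ?_ ?_ ?_ ?_ ?_ ?_ ?_ x
      ⟨by linarith, le_rfl⟩ y ⟨hz.2.1, hz.2.2.le⟩
    · exact key
    · intro y hy
      have := hy.1
      beta_reduce; positivity
    · intro y hy
      have := Real.hasDerivAt_rpow_const (x := y) (p := 1 / 2) (Or.inl hy.1.ne')
      refine this.congr_deriv ?_
      norm_num
    · intro y hy
      have := (Real.hasDerivAt_rpow_const (x := y) (p := -1 / 2) (Or.inl hy.1.ne')).const_mul (1 / 2)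
      refine this.congr_deriv ?_
      norm_num; ring
    · exact fun x _ y _ => bb_nonneg (x + h) y
    · intro x _ y _
      have := mul_nonneg (c3_nonneg (w := w) (x + h) y) (neg_nonneg.2 (H.hPn (x + h)))
      beta_reduce; linarith
    · intro x hx y hy
      have hm := hsub (show (x, y) ∈ _ from ⟨hx, hy⟩)
      have h1 := Dy_congr hΩh (v := fun x y => Dy g (x + h) y - Dy g x y) yG x y hm
      rw [h1, yyG x y hm, xG x y hm, hfyy _ _ (hs1 x y hm), hfyy _ _ (hs0 hm)]
      ring
    · intro x' hx y hy
      have hm := hsub (show (x', y) ∈ _ from ⟨hx, hy⟩)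
      obtain ⟨-, h2, h1⟩ := hG h hh.le x' y hm
      have h3 : y ^ (-1 : ℝ) ≤ y ^ (-3 / 2 : ℝ) :=
        Real.rpow_le_rpow_of_exponent_ge hy.1 (by linarith [hy.2, H.hd1]) (by norm_num)
      have h3' : 0 < y ^ (-1 : ℝ) := Real.rpow_pos_of_pos hy.1 _
      have h4 := mul_le_mul hxR h1 (abs_nonneg _) hR0
      have h5 : 0 ≤ R * (K * d' ^ (-1 / 2 : ℝ)) / d' ^ (1 / 2 : ℝ) := by positivity
      have h7 : h * ((K + R * K) * y ^ (-1 : ℝ)) < h * ((A * (1 / 4)) * y ^ (-1 : ℝ)) :=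
        mul_lt_mul_of_pos_left (mul_lt_mul_of_pos_right (by linarith) h3') hh
      have h8 : h * ((A * (1 / 4)) * y ^ (-1 : ℝ)) ≤ h * ((A * (1 / 4)) * y ^ (-3 / 2 : ℝ)) := by
        gcongr
      beta_reduce
      linarith
    · intro x' hx
      have hm := hsub (show (x', d') ∈ _ from ⟨hx, ⟨hd'0, le_rfl⟩⟩)
      have h1 := mul_le_mul hxR (hG h hh.le x' d' hm).1 (abs_nonneg _) hR0
      refine h1.trans ?_
      calc R * (h * (K * d' ^ (-1 / 2 : ℝ)))
          = h * (R * (K * d' ^ (-1 / 2 : ℝ)) / d' ^ (1 / 2 : ℝ)) * d' ^ (1 / 2 : ℝ) := by field_simp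
        _ ≤ h * A * d' ^ (1 / 2 : ℝ) := by
          apply mul_le_mul_of_nonneg_right _ hq.le
          apply mul_le_mul_of_nonneg_left _ hh.le
          have : 0 ≤ K + R * K := by positivity
          linarith
    · intro σ hσ
      obtain ⟨ρ, hρ, hh⟩ := rpow_small (s := 1) (by norm_num) (R * (2 * Cg)) (by positivity) hσ
      refine ⟨ρ, hρ, fun x' hx y hy hy' => ?_⟩
      have hm := hsub (show (x', y) ∈ _ from ⟨hx, hy⟩)
      have h1 := hgb _ _ (hs1 x' y hm)
      have h2 := hgb _ _ (hs0 hm)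
      have h3 := abs_sub (g (x' + h) y) (g x' y)
      refine (mul_le_mul hxR (h3.trans (add_le_add h1 h2)) (abs_nonneg _) hR0).trans ?_
      have := hh y hy.1 hy'
      linarith
  have hlim := (hgs.hx hΩ hzΩ).tendsto_slope_zero_right
  have h2 : Tendsto (fun t => (x - l1) * |t⁻¹ • (g (x + t) y - g x y)|) (𝓝[>] 0)
      (𝓝 ((x - l1) * |Dx g x y|)) := hlim.abs.const_mul _
  have h3 : (x - l1) * |Dx g x y| ≤ A * y ^ (1 / 2 : ℝ) := by
    refine le_of_tendsto h2 ?_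
    filter_upwards [Ioo_mem_nhdsGT (show (0 : ℝ) < X - x by linarith)] with t ht
    have := main t ht.1 ht.2
    rw [smul_eq_mul, abs_mul, abs_of_pos (inv_pos.2 ht.1)]
    have h4 := mul_le_mul_of_nonneg_left this (inv_pos.2 ht.1).le
    have h5 : t⁻¹ * (t * A * y ^ (1 / 2 : ℝ)) = A * y ^ (1 / 2 : ℝ) := by
      have := ht.1.ne'; field_simp
    linarith
  rw [div_mul_eq_mul_div, le_div_iff₀ (by linarith)]
  have h4 : (l' - l1) * |Dx g x y| ≤ (x - l1) * |Dx g x y| :=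
    mul_le_mul_of_nonneg_right (by linarith) (abs_nonneg _)
  linarith

end rounds


section runs
variable {w : ℝ → ℝ → ℝ} {P : ℝ → ℝ} {m M X l d : ℝ}

lemma Dx_cmul (c : ℝ) (u : ℝ → ℝ → ℝ) : Dx (fun x y => c * u x y) = fun x y => c * Dx u x y := by
  funext x y; simp only [Dx, deriv_const_mul_field]
lemma Dy_cmul (c : ℝ) (u : ℝ → ℝ → ℝ) : Dy (fun x y => c * u x y) = fun x y => c * Dy u x y := by
  funext x y
  exact deriv_const_mul_field c

lemma Sm_const {Ω : Set (ℝ × ℝ)} (c : ℝ) : Sm Ω (fun _ _ => c) := contDiffOn_const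

lemma Bd.rect {Ω : Set (ℝ × ℝ)} {s : ℝ} {u : ℝ → ℝ → ℝ} (h : Bd Ω s u) :
    ∃ C, 0 ≤ C ∧ ∀ r x y, 0 < r → y ∈ Icc (r / 2) (3 * r / 2) → (x, y) ∈ Ω →
      |u x y| ≤ C * r ^ s := by
  obtain ⟨C, hC, h⟩ := h
  refine ⟨C * 2 ^ |s|, by positivity, fun r x y hr hy hz => (h x y hz).trans ?_⟩
  have hy0 : 0 < y := lt_of_lt_of_le (by linarith) hy.1
  have e : y = y / r * r := by field_simp
  have ht0 : 1 / 2 ≤ y / r := by rw [le_div_iff₀ hr]; linarith [hy.1]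
  have ht1 : y / r ≤ 2 := by rw [div_le_iff₀ hr]; linarith [hy.2]
  have key : (y / r) ^ s ≤ 2 ^ |s| := by
    rcases le_total 0 s with hs | hs
    · rw [abs_of_nonneg hs]
      exact Real.rpow_le_rpow (by positivity) ht1 hs
    · rw [abs_of_nonpos hs, Real.rpow_neg (by norm_num), ← Real.inv_rpow (by norm_num)]
      exact Real.rpow_le_rpow_of_nonpos (by norm_num) (by linarith) hs
  have e2 : y ^ s = (y / r) ^ s * r ^ s := by
    rw [← Real.mul_rpow (by positivity) hr.le, ← e]
  rw [e2, mul_assoc]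
  exact mul_le_mul_of_nonneg_left (mul_le_mul_of_nonneg_right key (by positivity)) hC

lemma L_sq {Ω : Set (ℝ × ℝ)} (hΩ : IsOpen Ω) {v : ℝ → ℝ → ℝ} (hv : Sm Ω v) (c b : ℝ) {x y : ℝ}
    (hz : (x, y) ∈ Ω) :
    b * Dx (fun x y => c * (v x y * v x y)) x y - Dy (Dy (fun x y => c * (v x y * v x y))) x y
      = c * (2 * v x y * (b * Dx v x y - Dy (Dy v) x y) - 2 * Dy v x y ^ 2) := by
  have h1 := Dx_mul hΩ hv hv x y hz
  have h2 := Dy_congr hΩ (Dy_mul hΩ hv hv) x y hz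
  have h3 := Dy_add hΩ ((hv.dy hΩ).mul hv) (hv.mul (hv.dy hΩ)) x y hz
  have h4 := Dy_mul hΩ (hv.dy hΩ) hv x y hz
  have h5 := Dy_mul hΩ hv (hv.dy hΩ) x y hz
  rw [Dx_cmul, Dy_cmul, Dy_cmul]
  beta_reduce at h1 h3 h4 h5 ⊢
  rw [h1, h2, h3, h4, h5]
  ring

lemma Base.rhs_sm (H : Base w P m M X l d) (n : ℕ) :
    Sm (Reg l X d) (bb w) ∧ Sm (Reg l X d) (EE w P (n + 1)) ∧ Sm (Reg l X d) (SS w P n) ∧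
    Sm (Reg l X d) (Dx^[n + 1] w) :=
  have hΩ := Reg_open l X d
  ⟨bb_sm H.hp H.hm H.hw H.hwm, EE_sm hΩ H.hp H.hm H.hw H.hwm H.hP _,
    SS_sm hΩ H.hp H.hm H.hw H.hwm H.hP n, H.hw.dxn hΩ _⟩

lemma L_fy (H : Base w P m M X l d) (n : ℕ) {x y : ℝ} (hz : (x, y) ∈ Reg l X d) :
    bb w x y * Dx (Dy (Dx^[n + 1] w)) x y - Dy (Dy (Dy (Dx^[n + 1] w))) x y
    = -(Dy (bb w) x y * Dx (Dx^[n + 1] w) x y + Dy (EE w P (n + 1)) x y * Dx^[n + 1] w x y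
      + EE w P (n + 1) x y * Dy (Dx^[n + 1] w) x y + Dy (SS w P n) x y) := by
  have hΩ := Reg_open l X d
  obtain ⟨hb, he, hS, hf⟩ := H.rhs_sm n
  have h1 := Dy_congr hΩ (H.fyy n) x y hz
  have h2 := ((((hb.hy hΩ hz).mul ((hf.dx hΩ).hy hΩ hz)).add ((he.hy hΩ hz).mul (hf.hy hΩ hz))).add
    (hS.hy hΩ hz)).deriv
  have h3 := hf.comm hΩ x y hz
  rw [h1, h3]
  have h4 := h2
  change Dy (fun x y => bb w x y * Dx (Dx^[n + 1] w) x y + EE w P (n + 1) x y * Dx^[n + 1] w x y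
      + SS w P n x y) x y = _ at h4
  rw [h4]; ring

lemma L_fx (H : Base w P m M X l d) (n : ℕ) {x y : ℝ} (hz : (x, y) ∈ Reg l X d) :
    bb w x y * Dx (Dx (Dx^[n + 1] w)) x y - Dy (Dy (Dx (Dx^[n + 1] w))) x y
    = -(Dx (bb w) x y * Dx (Dx^[n + 1] w) x y + Dx (EE w P (n + 1)) x y * Dx^[n + 1] w x y
      + EE w P (n + 1) x y * Dx (Dx^[n + 1] w) x y + Dx (SS w P n) x y) := by
  have hΩ := Reg_open l X d
  obtain ⟨hb, he, hS, hf⟩ := H.rhs_sm n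
  have h1 := Dx_congr hΩ (H.fyy n) x y hz
  have h2 := ((((hb.hx hΩ hz).mul ((hf.dx hΩ).hx hΩ hz)).add ((he.hx hΩ hz).mul (hf.hx hΩ hz))).add
    (hS.hx hΩ hz)).deriv
  have h3 := (hf.dy hΩ).comm hΩ x y hz
  have h5 := Dy_congr hΩ (hf.comm hΩ) x y hz
  rw [← h5, ← h3, h1]
  have h4 := h2
  change Dx (fun x y => bb w x y * Dx (Dx^[n + 1] w) x y + EE w P (n + 1) x y * Dx^[n + 1] w x y
      + SS w P n x y) x y = _ at h4
  rw [h4]; ring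

lemma rect_sub {l1 x r : ℝ} (hl : l < l1) (hx : x < X) (hr : 0 < r) (hr2 : r < d / 2) :
    Icc l1 x ×ˢ Icc (r / 2) (3 * r / 2) ⊆ Reg l X d := by
  rintro ⟨a, b⟩ ⟨⟨h1, h2⟩, h3, h4⟩
  simp only at *
  exact ⟨⟨by simp only; linarith, by simp only; linarith⟩, ⟨by simp only; linarith, by simp only; linarith⟩⟩

lemma runA (H : Base w P m M X l d) {n : ℕ} (hcl : Cl (Reg l X d) (n + 1) 1 w)
    (hf : Bd (Reg l X d) 1 (Dx^[n + 2] w)) {l' : ℝ} (hl' : l < l') :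
    Bd (Reg l' X (d / 2)) 0 (Dy (Dx^[n + 2] w)) := by
  have hΩ := Reg_open l X d
  have hp := H.hp
  obtain ⟨hbs, hes, hSs, hfs⟩ := H.rhs_sm (n + 1)
  have hbb := bb_bd hp H.hm H.hwm
  have heC : Cl (Reg l X d) 0 (-3 / 2) (EE w P (n + 2)) :=
    EE_cl hΩ hp H.hm H.hwm H.hl H.hP (hcl.down (by omega))
  have hSC := SS_cl hΩ hp H.hm H.hwm H.hl H.hP n 0 (by simpa using hcl)
  have hfyy := H.fyy (n + 1)
  have hLfy := fun x y hz => L_fy H (n + 1) (x := x) (y := y) hz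
  have hby := bb_dy hΩ hp H.hm H.hw H.hwm
  have hwy : Bd (Reg l X d) 0 (Dy w) := by simpa using hcl.bdy
  change Sm _ (Dx^[n + 2] w) at hfs
  change EqR _ (Dy (Dy (Dx^[n + 2] w))) (fun x y => bb w x y * Dx (Dx^[n + 2] w) x y
    + EE w P (n + 2) x y * Dx^[n + 2] w x y + SS w P (n + 1) x y) at hfyy
  change ∀ x y, (x, y) ∈ Reg l X d →
    bb w x y * Dx (Dy (Dx^[n + 2] w)) x y - Dy (Dy (Dy (Dx^[n + 2] w))) x y
    = -(Dy (bb w) x y * Dx (Dx^[n + 2] w) x y + Dy (EE w P (n + 2)) x y * Dx^[n + 2] w x y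
      + EE w P (n + 2) x y * Dy (Dx^[n + 2] w) x y + Dy (SS w P (n + 1)) x y) at hLfy
  generalize Dx^[n + 2] w = f at *
  generalize EE w P (n + 2) = e at *
  generalize SS w P (n + 1) = S at *
  have ha1 : Bd (Reg l X d) (-1) (fun x y => 1 / 2 * (bb w x y * bb w x y * Dy w x y)) :=
    ((hbb.mul hp hbb rfl).mul hp hwy (by norm_num)).cmul _
  have hef : Bd (Reg l X d) (-1 / 2) (fun x y => e x y * f x y + S x y) :=
    (heC.bd.mul hp hf (by norm_num)).add hSC.bd
  have ha2 : Bd (Reg l X d) (-2) e := heC.bd.weak hp (by norm_num)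
  have ha3 : Bd (Reg l X d) (-2) (fun x y =>
      1 / 2 * (bb w x y * bb w x y * Dy w x y) * (e x y * f x y + S x y)
      + (Dy e x y * f x y + Dy S x y)) :=
    ((ha1.mul hp hef rfl).weak hp (by norm_num)).add
      (((heC.bdy.mul hp hf rfl).weak hp (by norm_num)).add (hSC.bdy.weak hp (by norm_num)))
  have ha4 : Bd (Reg l X d) 0 (fun x y => f x y * (e x y * f x y + S x y)) :=
    (hf.mul hp hef rfl).weak hp (by norm_num)
  have ha5 : Bd (Reg l X d) (-2) (bb w) := hbb.weak hp (by norm_num)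
  have ha6 : Bd (Reg l X d) 2 (fun x y => f x y * f x y) := hf.mul hp hf (by norm_num)
  obtain ⟨k1, hk1, ha1⟩ := ha1.rect
  obtain ⟨k2, hk2, ha2⟩ := ha2.rect
  obtain ⟨k3, hk3, ha3⟩ := ha3.rect
  obtain ⟨k4, hk4, ha4⟩ := ha4.rect
  obtain ⟨k5, hk5, ha5⟩ := ha5.rect
  obtain ⟨k6, hk6, ha6⟩ := ha6.rect
  set K := k1 + k2 + k3 + 2 * k4 + k5 + k6 with hK
  set l1 := (l + l') / 2 with hl1
  obtain ⟨C, hC, hbern⟩ := bern_est K 1 |X - l1| (by positivity) one_pos (abs_nonneg _)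
  refine ⟨√C / (l' - l1), div_nonneg (Real.sqrt_nonneg _) (by linarith), fun x r hz => ?_⟩
  have hr : 0 < r := hz.2.1
  have hxl : l' < x := hz.1.1
  have hxX : x < X := hz.1.2
  have hr2 : r < d / 2 := hz.2.2
  have hsub := rect_sub (l := l) (l1 := l1) (by linarith) hxX hr hr2
  have key := hbern (Reg l X d) l1 x r (Dy f) (fun x y => r⁻¹ ^ 2 * (f x y * f x y)) (bb w) hΩ
    (le_trans (by linarith) (le_abs_self _)) hr hsub (hfs.dy hΩ)
    (Sm.mul (Sm_const _) (hfs.mul hfs)) ?_ x ⟨by linarith, le_rfl⟩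
  · have h1 : (l' - l1) ^ 2 * Dy f x r ^ 2 ≤ C :=
      (mul_le_mul_of_nonneg_right (pow_le_pow_left₀ (by linarith) (by linarith) 2) (sq_nonneg _)).trans key
    rw [Real.rpow_zero, mul_one, le_div_iff₀ (by linarith)]
    apply Real.le_sqrt_of_sq_le
    rw [mul_pow, sq_abs]; linarith
  · intro x' y hxy
    have hm := hsub hxy
    have q2 : r ^ (-2 : ℝ) = r⁻¹ ^ 2 := by
      rw [Real.rpow_neg hr.le, inv_pow]; norm_num
    have q1 : r ^ (-1 : ℝ) = r⁻¹ := by rw [Real.rpow_neg_one]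
    have b1 := ha1 r x' y hr hxy.2 hm
    have b2 := ha2 r x' y hr hxy.2 hm
    have b3 := ha3 r x' y hr hxy.2 hm
    have b4 := ha4 r x' y hr hxy.2 hm
    have b5 := ha5 r x' y hr hxy.2 hm
    have b6 := ha6 r x' y hr hxy.2 hm
    rw [q2] at b2 b3 b5
    rw [q1] at b1
    rw [Real.rpow_zero, mul_one] at b4
    have q3 : r ^ (2 : ℝ) = r ^ 2 := by norm_num
    rw [q3] at b6
    rw [abs_of_nonneg (bb_nonneg _ _)] at b5
    rw [L_sq hΩ hfs _ _ hm, hLfy _ _ hm, hby _ _ hm]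
    have hyy := hfyy _ _ hm
    beta_reduce at hyy b1 b3 b4 b6 ⊢
    simp only [c3]
    have hq : 0 < r⁻¹ := inv_pos.2 hr
    have hrq : r ^ 2 * r⁻¹ ^ 2 = 1 := by field_simp
    generalize r⁻¹ = q at *
    generalize Dy (Dy f) x' y = fyy at *
    generalize Dx f x' y = fx at *
    generalize Dy f x' y = fy at *
    generalize f x' y = f0 at *
    generalize Dy e x' y = ey at *
    generalize Dy S x' y = Sy at *
    generalize e x' y = e0 at *
    generalize S x' y = S0 at *
    have hb0 := bb_nonneg (w := w) x' y
    generalize bb w x' y = b at *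
    generalize Dy w x' y = wy at *
    have hq2 : 0 ≤ q ^ 2 := by positivity
    have hle : ∀ k, k ≤ K → k * q ^ 2 ≤ K * q ^ 2 := fun k h => mul_le_mul_of_nonneg_right h hq2
    refine ⟨hb0, b5.trans (hle _ (by linarith)), ?_, ?_, ?_⟩
    · have e1 : -(-(1 / 2) * (b * (b * b) * wy) * fx + ey * f0 + e0 * fy + Sy)
          = 1 / 2 * (b * b * wy) * fyy - e0 * fy
            - (1 / 2 * (b * b * wy) * (e0 * f0 + S0) + (ey * f0 + Sy)) := by
        rw [hyy]; ring
      rw [e1]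
      have c1 := abs_sub (1 / 2 * (b * b * wy) * fyy - e0 * fy)
        (1 / 2 * (b * b * wy) * (e0 * f0 + S0) + (ey * f0 + Sy))
      have c2 := abs_sub (1 / 2 * (b * b * wy) * fyy) (e0 * fy)
      rw [abs_mul _ fyy, abs_mul e0] at c2
      have d1 := mul_le_mul_of_nonneg_right (b1.trans (mul_le_mul_of_nonneg_right (show k1 ≤ K by linarith) hq.le)) (abs_nonneg fyy)
      have d2 := mul_le_mul_of_nonneg_right (b2.trans (hle k2 (by linarith))) (abs_nonneg fy)
      have d3 := b3.trans (hle k3 (by linarith))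
      linarith
    · have e1 : b * fx - fyy = -(e0 * f0 + S0) := by rw [hyy]; ring
      rw [e1]
      have d4 := (abs_le.1 b4).1
      have : q ^ 2 * (2 * f0 * -(e0 * f0 + S0)) ≤ q ^ 2 * K :=
        mul_le_mul_of_nonneg_left (by linarith) hq2
      have : 0 ≤ q ^ 2 * fy ^ 2 := by positivity
      linarith
    · rw [abs_mul, abs_of_nonneg hq2]
      calc q ^ 2 * |f0 * f0| ≤ q ^ 2 * (k6 * r ^ 2) := mul_le_mul_of_nonneg_left b6 hq2
        _ = k6 := by linear_combination k6 * hrq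
        _ ≤ K := by linarith

end runs


section runs
variable {w : ℝ → ℝ → ℝ} {P : ℝ → ℝ} {m M X l d : ℝ}

set_option maxHeartbeats 800000 in
lemma runB (H : Base w P m M X l d) {n : ℕ} (hcl : Cl (Reg l X d) (n + 2) 1 w)
    {l' : ℝ} (hl' : l < l') :
    Bd (Reg l' X (d / 2)) (-1 / 2) (Dx (Dx^[n + 2] w)) := by
  have hΩ := Reg_open l X d
  have hp := H.hp
  obtain ⟨hbs, hes, hSs, hfs⟩ := H.rhs_sm (n + 1)
  have hbC := bb_cl hΩ hp H.hm H.hwm (hcl.down (by omega : 1 ≤ n + 2))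
  have heC : Cl (Reg l X d) 1 (-3 / 2) (EE w P (n + 2)) :=
    EE_cl hΩ hp H.hm H.hwm H.hl H.hP (hcl.down (by omega))
  have hSC := SS_cl hΩ hp H.hm H.hwm H.hl H.hP n 1 (hcl.down (by omega))
  have hfyy := H.fyy (n + 1)
  have hLfy := fun x y hz => L_fy H (n + 1) (x := x) (y := y) hz
  have hLfx := fun x y hz => L_fx H (n + 1) (x := x) (y := y) hz
  have hfC : Cl (Reg l X d) 0 1 (Dx^[n + 2] w) := Cl.dxn (n + 2) (by simpa using hcl)
  change Sm _ (Dx^[n + 2] w) at hfs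
  change EqR _ (Dy (Dy (Dx^[n + 2] w))) (fun x y => bb w x y * Dx (Dx^[n + 2] w) x y
    + EE w P (n + 2) x y * Dx^[n + 2] w x y + SS w P (n + 1) x y) at hfyy
  change ∀ x y, (x, y) ∈ Reg l X d →
    bb w x y * Dx (Dy (Dx^[n + 2] w)) x y - Dy (Dy (Dy (Dx^[n + 2] w))) x y
    = -(Dy (bb w) x y * Dx (Dx^[n + 2] w) x y + Dy (EE w P (n + 2)) x y * Dx^[n + 2] w x y
      + EE w P (n + 2) x y * Dy (Dx^[n + 2] w) x y + Dy (SS w P (n + 1)) x y) at hLfy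
  change ∀ x y, (x, y) ∈ Reg l X d →
    bb w x y * Dx (Dx (Dx^[n + 2] w)) x y - Dy (Dy (Dx (Dx^[n + 2] w))) x y
    = -(Dx (bb w) x y * Dx (Dx^[n + 2] w) x y + Dx (EE w P (n + 2)) x y * Dx^[n + 2] w x y
      + EE w P (n + 2) x y * Dx (Dx^[n + 2] w) x y + Dx (SS w P (n + 1)) x y) at hLfx
  generalize Dx^[n + 2] w = f at *
  generalize EE w P (n + 2) = e at *
  generalize SS w P (n + 1) = S at *
  have hf : Bd (Reg l X d) 1 f := hfC.bd
  have hfy : Bd (Reg l X d) 0 (Dy f) := by simpa using hfC.bdy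
  have ha1 : Bd (Reg l X d) (-2) (fun x y => Dx (bb w) x y + e x y) :=
    (hbC.dx.bd.weak hp (by norm_num)).add (heC.bd.weak hp (by norm_num))
  have ha2 : Bd (Reg l X d) (-2) (fun x y => Dx e x y * f x y + Dx S x y) :=
    ((heC.dx.bd.mul hp hf rfl).weak hp (by norm_num)).add (hSC.dx.bd.weak hp (by norm_num))
  have ha5 : Bd (Reg l X d) (-3 / 2) (fun x y => Dy f x y * Dy (bb w) x y) :=
    hfy.mul hp hbC.bdy (by norm_num)
  have ha6 : Bd (Reg l X d) (-2) (fun x y => Dy f x y * (Dy e x y * f x y + (e x y * Dy f x y + Dy S x y))) := by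
    refine Bd.mul hp hfy (s := -2) (Bd.add ?_ (Bd.add ?_ ?_)) (by norm_num)
    · exact (heC.bdy.mul hp hf rfl).weak hp (by norm_num)
    · exact (heC.bd.mul hp hfy rfl).weak hp (by norm_num)
    · exact hSC.bdy.weak hp (by norm_num)
  have hef : Bd (Reg l X d) (-1 / 2) (fun x y => e x y * f x y + S x y) :=
    (heC.bd.mul hp hf (by norm_num)).add hSC.bd
  have ha7 : Bd (Reg l X d) (-2) (fun x y => (e x y * f x y + S x y) * (e x y * f x y + S x y)) :=
    (hef.mul hp hef rfl).weak hp (by norm_num)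
  have ha8 : Bd (Reg l X d) 0 (fun x y => Dy f x y * Dy f x y) := hfy.mul hp hfy (by norm_num)
  have ha9 : Bd (Reg l X d) (-2) (bb w) := hbC.bd.weak hp (by norm_num)
  obtain ⟨k1, hk1, ha1⟩ := ha1.rect
  obtain ⟨k2, hk2, ha2⟩ := ha2.rect
  obtain ⟨k5, hk5, ha5⟩ := ha5.rect
  obtain ⟨k6, hk6, ha6⟩ := ha6.rect
  obtain ⟨k7, hk7, ha7⟩ := ha7.rect
  obtain ⟨k8, hk8, ha8⟩ := ha8.rect
  obtain ⟨k9, hk9, ha9⟩ := ha9.rect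
  have hM := H.hM
  set κ := 2 / (3 * M) with hκ
  have hκ0 : 0 < κ := by positivity
  set Q := 2 * k5 ^ 2 / κ with hQ
  have hQ0 : 0 ≤ Q := by positivity
  have hQκ : Q * κ = 2 * k5 ^ 2 := by rw [hQ]; field_simp
  set K := k1 + k2 + Q + 2 * k6 + 2 * k7 + k8 + k9 with hK
  set l1 := (l + l') / 2 with hl1
  obtain ⟨C, hC, hbern⟩ := bern_est K (κ / 2) |X - l1| (by positivity) (by positivity) (abs_nonneg _)
  refine ⟨√C / (l' - l1), div_nonneg (Real.sqrt_nonneg _) (by linarith), fun x r hz => ?_⟩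
  have hr : 0 < r := hz.2.1
  have hxl : l' < x := hz.1.1
  have hxX : x < X := hz.1.2
  have hr2 : r < d / 2 := hz.2.2
  have hr1 : r < 1 := by linarith [H.hd1]
  have hsub := rect_sub (l := l) (l1 := l1) (by linarith) hxX hr hr2
  have key := hbern (Reg l X d) l1 x r (fun x y => √r * Dx f x y) (fun x y => 1 * (Dy f x y * Dy f x y)) (bb w) hΩ
    (le_trans (by linarith) (le_abs_self _)) hr hsub (Sm.mul (Sm_const _) (hfs.dx hΩ))
    (Sm.mul (Sm_const _) ((hfs.dy hΩ).mul (hfs.dy hΩ))) ?_ x ⟨by linarith, le_rfl⟩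
  · have h1 : (l' - l1) ^ 2 * (√r * Dx f x r) ^ 2 ≤ C :=
      (mul_le_mul_of_nonneg_right (pow_le_pow_left₀ (by linarith) (by linarith) 2) (sq_nonneg _)).trans key
    have h2 : r ^ (-1 / 2 : ℝ) = (√r)⁻¹ := by
      rw [Real.sqrt_eq_rpow, ← Real.rpow_neg hr.le]; norm_num
    have hs : 0 < √r := Real.sqrt_pos.2 hr
    rw [h2, ← div_eq_mul_inv, div_div, le_div_iff₀ (mul_pos (by linarith) hs)]
    apply Real.le_sqrt_of_sq_le
    calc (|Dx f x r| * ((l' - l1) * √r)) ^ 2 = (l' - l1) ^ 2 * (√r ^ 2 * |Dx f x r| ^ 2) := by ring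
      _ = (l' - l1) ^ 2 * (√r * Dx f x r) ^ 2 := by rw [sq_abs]; ring
      _ ≤ C := h1
  · intro x' y hxy
    have hm := hsub hxy
    have q2 : r ^ (-2 : ℝ) = r⁻¹ ^ 2 := by
      rw [Real.rpow_neg hr.le, inv_pow]; norm_num
    have q3 : r ^ (-3 / 2 : ℝ) = r⁻¹ ^ 2 * √r := by
      rw [← q2, Real.sqrt_eq_rpow, ← Real.rpow_add hr]; norm_num
    have b1 := ha1 r x' y hr hxy.2 hm
    have b2 := ha2 r x' y hr hxy.2 hm
    have b5 := ha5 r x' y hr hxy.2 hm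
    have b6 := ha6 r x' y hr hxy.2 hm
    have b7 := ha7 r x' y hr hxy.2 hm
    have b8 := ha8 r x' y hr hxy.2 hm
    have b9 := ha9 r x' y hr hxy.2 hm
    rw [q2] at b1 b2 b6 b7 b9
    rw [q3] at b5
    rw [Real.rpow_zero, mul_one] at b8
    rw [abs_of_nonneg (bb_nonneg _ _)] at b9
    have hbsq : κ * r⁻¹ ≤ bb w x' y * bb w x' y := by
      have hwp := w_pos hp H.hm H.hwm hm
      have e1 : bb w x' y * bb w x' y = (w x' y)⁻¹ := by
        simp only [bb]; rw [← mul_inv, Real.mul_self_sqrt hwp.le]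
      have hwu : w x' y ≤ 3 * M / 2 * r := by
        have h1 := H.hwM x' y hm
        have h2 := mul_le_mul_of_nonneg_left hxy.2.2 hM.le
        simp only at h2
        linarith
      rw [e1, hκ]
      calc 2 / (3 * M) * r⁻¹ = (3 * M / 2 * r)⁻¹ := by field_simp
        _ ≤ _ := inv_anti₀ hwp hwu
    have hLv : bb w x' y * Dx (fun x y => √r * Dx f x y) x' y - Dy (Dy (fun x y => √r * Dx f x y)) x' y
        = √r * (bb w x' y * Dx (Dx f) x' y - Dy (Dy (Dx f)) x' y) := by
      rw [Dx_cmul, Dy_cmul, Dy_cmul]; ring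
    rw [hLv, L_sq hΩ (hfs.dy hΩ) _ _ hm, hLfy _ _ hm, hLfx _ _ hm]
    have hyy := hfyy _ _ hm
    have hs1 : √r ≤ 1 := Real.sqrt_le_one.2 hr1.le
    have hs0 : 0 ≤ √r := Real.sqrt_nonneg r
    have hs2 : √r ^ 2 * r⁻¹ = 1 := by rw [Real.sq_sqrt hr.le]; field_simp
    beta_reduce at hyy b1 b2 b5 b6 b7 b8 ⊢
    have hq : 0 < r⁻¹ := inv_pos.2 hr
    have hDyv : 0 ≤ K * r⁻¹ * |Dy (fun x y => √r * Dx f x y) x' y| := by positivity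
    generalize |Dy (fun x y => √r * Dx f x y) x' y| = dyv at *
    generalize r⁻¹ = q at *
    generalize √r = s at *
    generalize Dy (Dy f) x' y = fyy at *
    generalize Dx f x' y = F at *
    generalize Dy f x' y = fy at *
    generalize f x' y = f0 at *
    generalize Dy e x' y = ey at *
    generalize Dy S x' y = Sy at *
    generalize Dx e x' y = ex at *
    generalize Dx S x' y = Sx at *
    generalize e x' y = e0 at *
    generalize S x' y = S0 at *
    have hb0 := bb_nonneg (w := w) x' y
    generalize Dx (bb w) x' y = bx at *
    generalize Dy (bb w) x' y = by' at *
    generalize bb w x' y = b at *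
    have hq2 : 0 ≤ q ^ 2 := by positivity
    have hle : ∀ k, k ≤ K → k * q ^ 2 ≤ K * q ^ 2 := fun k h => mul_le_mul_of_nonneg_right h hq2
    refine ⟨hb0, b9.trans (hle _ (by linarith)), ?_, ?_, ?_⟩
    · have e1 : s * -(bx * F + ex * f0 + e0 * F + Sx) = - ((bx + e0) * (s * F)) - s * (ex * f0 + Sx) := by
        ring
      rw [e1]
      have c1 := abs_sub (-((bx + e0) * (s * F))) (s * (ex * f0 + Sx))
      rw [abs_neg, abs_mul (bx + e0), abs_mul s (ex * f0 + Sx), abs_of_nonneg hs0] at c1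
      have d1 := mul_le_mul_of_nonneg_right (b1.trans (hle k1 (by linarith))) (abs_nonneg (s * F))
      have d2 : s * |ex * f0 + Sx| ≤ K * q ^ 2 := (mul_le_mul hs1 b2 (abs_nonneg _) zero_le_one).trans
        (by rw [one_mul]; exact hle k2 (by linarith))
      linarith
    · have hF2 : F ^ 2 = q * (s * F) ^ 2 := by linear_combination (-F ^ 2) * hs2
      have t1 : κ * q ^ 2 * (s * F) ^ 2 ≤ (b * b) * F ^ 2 := by
        rw [hF2]
        have := mul_le_mul_of_nonneg_right hbsq (mul_nonneg hq.le (sq_nonneg (s * F)))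
        linarith
      have t2 : |fy * by' * F| ≤ k5 * q ^ 2 * |s * F| := by
        rw [abs_mul]
        refine (mul_le_mul_of_nonneg_right b5 (abs_nonneg F)).trans (le_of_eq ?_)
        rw [abs_mul, abs_of_nonneg hs0]; ring
      have t3 : 2 * k5 * |s * F| ≤ κ / 2 * (s * F) ^ 2 + Q := by
        rw [← sq_abs (s * F)]
        have := sq_nonneg (κ * |s * F| - 2 * k5)
        have h0 : κ * (κ / 2 * |s * F| ^ 2 + Q) - κ * (2 * k5 * |s * F|)
            = 1 / 2 * (κ * |s * F| - 2 * k5) ^ 2 := by linear_combination hQκ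
        have h1 : κ * (2 * k5 * |s * F|) ≤ κ * (κ / 2 * |s * F| ^ 2 + Q) := by linarith
        exact le_of_mul_le_mul_left h1 hκ0
      have t4 := mul_le_mul_of_nonneg_left t3 hq2
      have u2 := (abs_le.1 t2).1
      have u6 := (abs_le.1 b6).1
      have u7 := (abs_le.1 b7).2
      have u8 := sq_nonneg (b * F + 2 * (e0 * f0 + S0))
      have e2 : fyy = b * F + (e0 * f0 + S0) := by rw [hyy]; ring
      rw [e2]
      have hfin : (Q + 2 * k6 + 2 * k7) * q ^ 2 ≤ K * q ^ 2 := hle _ (by linarith)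
      linarith
    · rw [one_mul]; exact b8.trans (by linarith)

end runs


section fin
variable {w : ℝ → ℝ → ℝ} {P : ℝ → ℝ} {m M X l d : ℝ}

lemma Cl_extend {Ω : Set (ℝ × ℝ)} {n : ℕ} {r : ℝ} : ∀ {u}, Cl Ω n r u →
    Cl Ω 0 r (Dx^[n + 1] u) → Cl Ω (n + 1) r u := by
  induction n with
  | zero => intro u h h'; exact ⟨h, h'⟩
  | succ n ih =>
    intro u h h'
    rw [Function.iterate_succ_apply] at h'
    exact ⟨h.1, ih h.2 h'⟩

lemma Cl_of {Ω : Set (ℝ × ℝ)} {n : ℕ} {r : ℝ} {u : ℝ → ℝ → ℝ}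
    (h : ∀ j ≤ n, Cl Ω 0 r (Dx^[j] u)) : Cl Ω n r u := by
  induction n with
  | zero => exact h 0 le_rfl
  | succ n ih => exact Cl_extend (ih fun j hj => h j (by omega)) (h (n + 1) le_rfl)

lemma interior_est (H : Base w P m M X l d) {n : ℕ} (hcl : Cl (Reg l X d) (n + 1) 1 w)
    (hf : Bd (Reg l X d) (-1 / 2) (Dx^[n + 2] w)) {l' : ℝ} (hl' : l < l') :
    ∃ d', 0 < d' ∧ d' ≤ d ∧ Bd (Reg l' X d') 0 (Dy (Dx^[n + 2] w)) ∧
      Bd (Reg l' X d') (-1) (Dy (Dy (Dx^[n + 2] w))) ∧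
      Bd (Reg l' X d') (-1 / 2) (Dx (Dx^[n + 2] w)) := by
  have hd := H.hd
  obtain ⟨l1, h1, h1'⟩ := exists_between hl'
  obtain ⟨l2, h2, h2'⟩ := exists_between h1'
  obtain ⟨l3, h3, h3'⟩ := exists_between h2'
  have H1 := H.mono h1.le (by linarith : 0 < d / 2) (by linarith)
  have s1 : Reg l1 X (d / 2) ⊆ Reg l X d := Reg_mono h1.le le_rfl (by linarith)
  have f1 := round1 H hcl hf h1 (d' := d / 2) (by linarith) (by linarith)
  have c1 := hcl.mono s1
  have H2 := H1.mono h2.le (by linarith : 0 < d / 4) (by linarith)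
  have s2 : Reg l2 X (d / 4) ⊆ Reg l1 X (d / 2) := Reg_mono h2.le le_rfl (by linarith)
  have f2 := round2 H1 c1 f1 h2 (d' := d / 4) (by linarith) (by linarith)
  have c2 := c1.mono s2
  have H3 := H2.mono h3.le (by linarith : 0 < d / 4 / 2) (by linarith)
  have s3 : Reg l3 X (d / 4 / 2) ⊆ Reg l2 X (d / 4) := Reg_mono h3.le le_rfl (by linarith)
  have f3 := runA H2 c2 f2 h3
  have c3' : Cl (Reg l3 X (d / 4 / 2)) (n + 2) 1 w :=
    Cl_extend (c2.mono s3) ⟨H3.hw.dxn (Reg_open _ _ _) _, f2.mono s3, by simpa using f3⟩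
  have f4 := runB H3 c3' h3'
  have s4 : Reg l' X (d / 4 / 2 / 2) ⊆ Reg l3 X (d / 4 / 2) := Reg_mono h3'.le le_rfl (by linarith)
  have H4 := H3.mono h3'.le (by linarith : 0 < d / 4 / 2 / 2) (by linarith)
  have c4 := c3'.mono s4
  refine ⟨d / 4 / 2 / 2, by linarith, by linarith, f3.mono s4, ?_, f4⟩
  have hΩ := Reg_open l' X (d / 4 / 2 / 2)
  have hp := H4.hp
  have heC : Cl (Reg l' X (d / 4 / 2 / 2)) 0 (-3 / 2) (EE w P (n + 1 + 1)) :=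
    EE_cl hΩ hp H4.hm H4.hwm H4.hl H4.hP (c4.down (by omega))
  have hSC := SS_cl hΩ hp H4.hm H4.hwm H4.hl H4.hP n 0 (c4.down (by omega))
  refine Bd.congr (Bd.add (Bd.add ?_ ?_) (hSC.bd.weak hp (by norm_num))) (H4.fyy (n + 1))
  · exact (bb_bd hp H4.hm H4.hwm).mul hp f4 (by norm_num)
  · exact (heC.bd.mul hp ((f2.mono s3).mono s4) rfl).weak hp (by norm_num)

lemma SmS.dy {u : ℝ → ℝ → ℝ}
    (hu : ContDiffOn ℝ ∞ (fun z : ℝ × ℝ => u z.1 z.2) (Ioc 0 X ×ˢ Ioi 0)) :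
    ContDiffOn ℝ ∞ (fun z : ℝ × ℝ => Dy u z.1 z.2) (Ioc 0 X ×ˢ Ioi 0) := by
  have hS : UniqueDiffOn ℝ (Ioc 0 X ×ˢ Ioi (0 : ℝ) : Set (ℝ × ℝ)) :=
    (uniqueDiffOn_Ioc 0 X).prod isOpen_Ioi.uniqueDiffOn
  have h1 := hu.fderivWithin hS (m := ∞) (by simp)
  refine (h1.clm_apply (contDiffOn_const (c := ((0 : ℝ), (1 : ℝ))))).congr ?_
  rintro ⟨x, y⟩ hz
  have h2 := ((hu.differentiableOn (by simp)) (x, y) hz).hasFDerivWithinAt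
  have h3 := h2.comp_hasDerivWithinAt (s := Ioi 0) y
    ((hasDerivAt_const y x).prodMk (hasDerivAt_id y)).hasDerivWithinAt (fun y' hy' => ⟨hz.1, hy'⟩)
  exact (h3.hasDerivAt (Ioi_mem_nhds hz.2)).deriv

lemma bdry_tendsto {G : ℝ → ℝ} (hX : 0 < X) (hG : ContDiffOn ℝ ∞ G (Ioc 0 X)) (n : ℕ) :
    iteratedDeriv n G X = 0 ∨
      Tendsto (iteratedDeriv n G) (𝓝[<] X) (𝓝 (iteratedDeriv n G X)) := by
  have hU := uniqueDiffOn_Ioc 0 X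
  have hXm : X ∈ Ioc 0 X := ⟨hX, le_rfl⟩
  have hGa : ∀ x ∈ Ioo 0 X, ContDiffAt ℝ ∞ G x := fun x hx =>
    hG.contDiffAt (mem_of_superset (isOpen_Ioo.mem_nhds hx) Ioo_subset_Ioc_self)
  have heq : ∀ n, EqOn (iteratedDerivWithin n G (Ioc 0 X)) (iteratedDeriv n G) (Ioo 0 X) :=
    fun n x hx => iteratedDerivWithin_eq_iteratedDeriv hU ((hGa x hx).of_le (by exact_mod_cast le_top)) (Ioo_subset_Ioc_self hx)
  have hmem : Ioo 0 X ∈ 𝓝[<] X := Ioo_mem_nhdsLT hX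
  have hlim : ∀ n, Tendsto (iteratedDeriv n G) (𝓝[<] X) (𝓝 (iteratedDerivWithin n G (Ioc 0 X) X)) := by
    intro n
    have h1 : ContinuousOn (iteratedDerivWithin n G (Ioc 0 X)) (Ioc 0 X) :=
      hG.continuousOn_iteratedDerivWithin (by exact_mod_cast le_top) hU
    have h2 : Tendsto (iteratedDerivWithin n G (Ioc 0 X)) (𝓝[Ioo 0 X] X) _ :=
      ((h1 X hXm).mono Ioo_subset_Ioc_self).tendsto
    rw [nhdsWithin_Ioo_eq_nhdsLT hX] at h2
    refine h2.congr' ?_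
    filter_upwards [hmem] with x hx using heq n hx
  rcases n with _ | n
  · right
    simpa using hlim 0
  · by_cases hd : DifferentiableAt ℝ (iteratedDeriv n G) X
    · right
      have hdiff : DifferentiableOn ℝ (iteratedDeriv n G) (Ioo 0 X) := by
        have h1 : DifferentiableOn ℝ (iteratedDerivWithin n G (Ioc 0 X)) (Ioc 0 X) :=
          hG.differentiableOn_iteratedDerivWithin (by exact_mod_cast ENat.coe_lt_top n) hU
        exact (h1.mono Ioo_subset_Ioc_self).congr fun x hx => (heq n hx).symm
      have h2 := hasDerivWithinAt_Iic_of_tendsto_deriv hdiff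
        hd.continuousAt.continuousWithinAt hmem (by
          have := hlim (n + 1)
          rwa [iteratedDeriv_succ] at this)
      have h3 := hd.hasDerivAt.hasDerivWithinAt (s := Iic X)
      have h4 := (uniqueDiffWithinAt_Iic X).eq_deriv _ h2 h3
      have h5 := hlim (n + 1)
      rw [h4] at h5
      rwa [iteratedDeriv_succ] at h5 ⊢
    · left
      rw [iteratedDeriv_succ]
      exact deriv_zero_of_not_differentiableAt hd

lemma bdry_bound {G : ℝ → ℝ} (hX : 0 < X) (hG : ContDiffOn ℝ ∞ G (Ioc 0 X)) (n : ℕ) {a B : ℝ}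
    (ha : a < X) (hB : 0 ≤ B) (h : ∀ x ∈ Ico a X, |iteratedDeriv n G x| ≤ B) :
    ∀ x ∈ Icc a X, |iteratedDeriv n G x| ≤ B := by
  intro x hx
  rcases hx.2.lt_or_eq with h1 | rfl
  · exact h x ⟨hx.1, h1⟩
  · rcases bdry_tendsto hX hG n with h2 | h2
    · rw [h2, abs_zero]; exact hB
    · refine le_of_tendsto h2.abs ?_
      filter_upwards [Ioo_mem_nhdsLT ha] with t ht using h t ⟨ht.1.le, ht.2⟩

lemma pd_bound (hX : 0 < X)
    (hu : ContDiffOn ℝ ∞ (fun z : ℝ × ℝ => w z.1 z.2) (Ioc 0 X ×ˢ Ioi 0)) (k j : ℕ) {a B y : ℝ}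
    (hy : 0 < y) (ha : a < X) (hB : 0 ≤ B) (h : ∀ x ∈ Ico a X, |pd k j w x y| ≤ B) :
    ∀ x ∈ Icc a X, |pd k j w x y| ≤ B := by
  have hj : ContDiffOn ℝ ∞ (fun z : ℝ × ℝ => pd 0 j w z.1 z.2) (Ioc 0 X ×ˢ Ioi 0) := by
    rw [pd_eq]
    clear h
    induction j with
    | zero => exact hu
    | succ j ih =>
      rw [Function.iterate_succ_apply']
      exact SmS.dy ih
  refine bdry_bound hX ?_ k ha hB h
  have hc : ContDiff ℝ ∞ (fun x : ℝ => (x, y)) := by fun_prop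
  have := hj.comp hc.contDiffOn (s := Ioc 0 X) (fun x hx => ⟨hx, hy⟩)
  simpa [pd, Function.comp_def] using this

end fin


/-- Third step of the induction: under `(IH_k)` on `[ε/2,X] × (0,δ₃]`, there exist
`δ₄ ∈ (0,δ₃]` and `C > 0` with `|∂_ψ ∂ₓ^k w| ≤ C`, `|∂_ψ² ∂ₓ^k w| ≤ C ψ⁻¹` and
`|∂ₓ^{k+1} w| ≤ C ψ^{-1/2}` on `[ε,X] × (0,δ₄]`. -/
theorem induction_step_three (X : ℝ) (p : ℝ → ℝ) (w : ℝ → ℝ → ℝ) (α m M C₀ δ₁ : ℝ)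
    (hw : OleinikSolution X p w α m M C₀ δ₁)
    (ε : ℝ) (hε : 0 < ε) (hεX : ε < X) (k : ℕ) (hk : 2 ≤ k)
    (δ₃ : ℝ) (hδ₃ : δ₃ ∈ Set.Ioo (0 : ℝ) 1) (hδ₃δ₁ : δ₃ ≤ δ₁)
    (C₁ : ℝ) (hC₁ : 0 < C₁)
    (hIH : IH k w (Set.Icc (ε / 2) X ×ˢ Set.Ioc (0 : ℝ) δ₃) C₁) :
    ∃ δ₄ ∈ Set.Ioc (0 : ℝ) δ₃, ∃ C > 0,
      ∀ x ∈ Set.Icc ε X, ∀ ψ ∈ Set.Ioc (0 : ℝ) δ₄,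
        |pd k 1 w x ψ| ≤ C ∧
        |pd k 2 w x ψ| ≤ C * ψ⁻¹ ∧
        |pd (k + 1) 0 w x ψ| ≤ C * ψ ^ (-(1 : ℝ) / 2) := by
  obtain ⟨n, rfl⟩ : ∃ n, k = n + 2 := ⟨k - 2, by omega⟩
  have hΩ := Reg_open (ε / 2) X δ₃
  have hmem : ∀ x y, (x, y) ∈ Reg (ε / 2) X δ₃ → ε / 2 < x ∧ x < X ∧ 0 < y ∧ y < δ₃ :=
    fun x y h => ⟨h.1.1, h.1.2, h.2.1, h.2.2⟩
  have hsub : Reg (ε / 2) X δ₃ ⊆ Ioc 0 X ×ˢ Ioi 0 := by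
    rintro ⟨x, y⟩ h
    obtain ⟨h1, h2, h3, h4⟩ := hmem x y h
    exact ⟨⟨by linarith, h2.le⟩, h3⟩
  have hsm : Sm (Reg (ε / 2) X δ₃) w := hw.smooth.mono hsub
  have hM : 0 < M := hw.hm.trans hw.hmM
  have H : Base w (deriv p) m M X (ε / 2) δ₃ := by
    refine ⟨hδ₃.1, hδ₃.2.le, hw.hm, hM, dP_smooth hw.hp, hw.hfav, hsm, ?_, ?_, ?_⟩
    · intro x y h
      obtain ⟨h1, h2, h3, h4⟩ := hmem x y h
      exact (hw.growth_lb x ⟨by linarith, h2.le⟩ y ⟨h3, by linarith⟩).le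
    · intro x y h
      obtain ⟨h1, h2, h3, h4⟩ := hmem x y h
      exact (hw.growth_ub x ⟨by linarith, h2.le⟩ y ⟨h3, by linarith⟩).le
    · intro x y h
      obtain ⟨h1, h2, h3, h4⟩ := hmem x y h
      have hl := hw.growth_lb x ⟨by linarith, h2.le⟩ y ⟨h3, by linarith⟩
      have hpos : 0 < √(w x y) := Real.sqrt_pos.2 (lt_trans (mul_pos hw.hm h3) hl)
      have he := hw.eqn x ⟨by linarith, h2.le⟩ y h3
      rw [pd_eq, pd_eq] at he
      change Dx w x y - √(w x y) * Dy (Dy w) x y = _ at he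
      change Dy (Dy w) x y = (√(w x y))⁻¹ * (Dx w x y + 2 * deriv p x)
      rw [inv_mul_eq_div, eq_div_iff hpos.ne']
      linarith
  have hIHm : ∀ x y, (x, y) ∈ Reg (ε / 2) X δ₃ →
      (x, y) ∈ Set.Icc (ε / 2) X ×ˢ Set.Ioc (0 : ℝ) δ₃ := by
    intro x y h
    obtain ⟨h1, h2, h3, h4⟩ := hmem x y h
    exact ⟨⟨h1.le, h2.le⟩, ⟨h3, h4.le⟩⟩
  have hcl : Cl (Reg (ε / 2) X δ₃) (n + 1) 1 w := by
    refine Cl_of fun j hj => ⟨hsm.dxn hΩ j, ⟨C₁, hC₁.le, fun x y h => ?_⟩,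
      ⟨C₁, hC₁.le, fun x y h => ?_⟩⟩
    · have h1 := ((hIH _ (hIHm x y h)).1 j (by omega)).2.2.1
      rw [pd_eq] at h1
      rw [Real.rpow_one]
      exact h1
    · have h1 := ((hIH _ (hIHm x y h)).1 j (by omega)).1
      rw [pd_eq] at h1
      rw [sub_self, Real.rpow_zero, mul_one, ← hsm.commn hΩ j x y h]
      exact h1
  have hf : Bd (Reg (ε / 2) X δ₃) (-1 / 2) (Dx^[n + 2] w) := by
    refine ⟨C₁, hC₁.le, fun x y h => ?_⟩
    have h1 := (hIH _ (hIHm x y h)).2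
    rw [pd_eq] at h1
    exact h1
  obtain ⟨d', hd0, hdle, ⟨A, hA0, hA⟩, ⟨B, hB0, hB⟩, ⟨D, hD0, hD⟩⟩ :=
    interior_est H hcl hf (show ε / 2 < 3 * ε / 4 by linarith)
  have hΩ' := Reg_open (3 * ε / 4) X d'
  have hsm' : Sm (Reg (3 * ε / 4) X d') w :=
    hsm.mono (Reg_mono (by linarith) le_rfl hdle)
  refine ⟨d' / 2, ⟨by linarith, by linarith⟩, A + B + D + 1, by linarith, ?_⟩
  intro x hx ψ hψ
  have hψ0 : 0 < ψ := hψ.1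
  have hψd : ψ < d' := by linarith [hψ.2]
  have hmem' : ∀ x ∈ Ico ε X, (x, ψ) ∈ Reg (3 * ε / 4) X d' :=
    fun x hx => ⟨⟨by linarith [hx.1], hx.2⟩, ⟨hψ0, hψd⟩⟩
  have hi : 0 < ψ⁻¹ := inv_pos.2 hψ0
  have hr : 0 < ψ ^ (-(1 : ℝ) / 2) := Real.rpow_pos_of_pos hψ0 _
  refine ⟨pd_bound hw.hX hw.smooth (n + 2) 1 hψ0 hεX (by linarith) ?_ x hx,
    pd_bound hw.hX hw.smooth (n + 2) 2 hψ0 hεX (by positivity) ?_ x hx,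
    pd_bound hw.hX hw.smooth (n + 2 + 1) 0 hψ0 hεX (by positivity) ?_ x hx⟩
  · intro x hx
    have h1 := hA x ψ (hmem' x hx)
    rw [Real.rpow_zero, mul_one, ← hsm'.commn hΩ' (n + 2) x ψ (hmem' x hx)] at h1
    rw [pd_eq]
    exact h1.trans (by linarith)
  · intro x hx
    have h1 := hB x ψ (hmem' x hx)
    rw [Real.rpow_neg_one, ← Dy_congr hΩ' (hsm'.commn hΩ' (n + 2)) x ψ (hmem' x hx),
      ← (hsm'.dy hΩ').commn hΩ' (n + 2) x ψ (hmem' x hx)] at h1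
    rw [pd_eq]
    exact h1.trans (mul_le_mul_of_nonneg_right (by linarith) hi.le)
  · intro x hx
    have h1 := hD x ψ (hmem' x hx)
    rw [pd_eq, Function.iterate_succ_apply']
    exact h1.trans (mul_le_mul_of_nonneg_right (by linarith) hr.le)
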